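/- arXiv:1603.04193 — 2 statements merged into one kernel-verified Lean document; each statement's English description precedes it below -/
import Mathlib

section
/- Let X ⊆ ℝⁿ be a central real algebraic set. Then every rational continuous function on X is a semi-algebraic function, i.e. its graph is a semi-algebraic subset of ℝⁿ⁺¹. -/
open MvPolynomial Set

/-- A real algebraic set: the common zero locus of finitely many real polynomials. -/
def IsRealAlgebraicSet {n : ℕ} (X : Set (Fin n → ℝ)) : Prop :=
  ∃ (k : ℕ) (p : Fin k → MvPolynomial (Fin n) ℝ),
    X = {x | ∀ i, MvPolynomial.eval x (p i) = 0}

/-- `V` is a real algebraic subset of `X`, i.e. a Zariski closed subset of `X`. -/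
def IsZariskiClosedIn {n : ℕ} (X V : Set (Fin n → ℝ)) : Prop :=
  IsRealAlgebraicSet V ∧ V ⊆ X

/-- `U` is a Zariski open subset of `X`. -/
def IsZariskiOpenIn {n : ℕ} (X U : Set (Fin n → ℝ)) : Prop :=
  U ⊆ X ∧ IsRealAlgebraicSet (X \ U)

/-- `U` is Zariski dense in `X`. -/
def IsZariskiDenseIn {n : ℕ} (X U : Set (Fin n → ℝ)) : Prop :=
  ∀ V, IsZariskiClosedIn X V → U ⊆ V → V = X

/-- `f` is regular on `U` : on `U`, `f = p / q` with `q` nonvanishing on `U`. -/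
def IsRegularOnSet {n : ℕ} (U : Set (Fin n → ℝ)) (f : (Fin n → ℝ) → ℝ) : Prop :=
  ∃ p q : MvPolynomial (Fin n) ℝ,
    (∀ x ∈ U, MvPolynomial.eval x q ≠ 0) ∧
    ∀ x ∈ U, f x = MvPolynomial.eval x p / MvPolynomial.eval x q

/-- A rational continuous function on `X`: continuous on `X` (euclidean topology) and
regular on a Zariski-dense Zariski-open subset of `X`. -/
def IsRatCont {n : ℕ} (X : Set (Fin n → ℝ)) (f : (Fin n → ℝ) → ℝ) : Prop :=
  ContinuousOn f X ∧
    ∃ U, IsZariskiOpenIn X U ∧ IsZariskiDenseIn X U ∧ IsRegularOnSet U f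

/-- A regulous function on `ℝⁿ`: continuous, and equal to a quotient of polynomials on a
nonempty Zariski open subset of `ℝⁿ`. -/
def IsRegulous {n : ℕ} (f : (Fin n → ℝ) → ℝ) : Prop :=
  Continuous f ∧
    ∃ U : Set (Fin n → ℝ), IsZariskiOpenIn Set.univ U ∧ U.Nonempty ∧ IsRegularOnSet U f

/-- A regulous function on `X`: the restriction to `X` of a regulous function on `ℝⁿ`. -/
def IsRegulousOn {n : ℕ} (X : Set (Fin n → ℝ)) (f : (Fin n → ℝ) → ℝ) : Prop :=
  ∃ g : (Fin n → ℝ) → ℝ, IsRegulous g ∧ ∀ x ∈ X, f x = g x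

/-- The largest Zariski open subset of `X` on which `f` is regular. -/
def regularDomain {n : ℕ} (X : Set (Fin n → ℝ)) (f : (Fin n → ℝ) → ℝ) : Set (Fin n → ℝ) :=
  ⋃₀ {U | IsZariskiOpenIn X U ∧ IsRegularOnSet U f}

/-- The polar locus of `f` on `X`. -/
def polarLocus {n : ℕ} (X : Set (Fin n → ℝ)) (f : (Fin n → ℝ) → ℝ) : Set (Fin n → ℝ) :=
  X \ regularDomain X f

/-- The ideal of polynomials vanishing on `X`. -/
noncomputable def vanishingIdealOf {n : ℕ} (X : Set (Fin n → ℝ)) : Ideal (MvPolynomial (Fin n) ℝ) where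
  carrier := {p | ∀ x ∈ X, MvPolynomial.eval x p = 0}
  add_mem' := by
    intro a b ha hb x hx
    simp [map_add, ha x hx, hb x hx]
  zero_mem' := by intro x hx; simp
  smul_mem' := by
    intro c p hp x hx
    simp [smul_eq_mul, map_mul, hp x hx]

/-- The dimension of `X`: the Krull dimension of its coordinate ring. -/
noncomputable def algDim {n : ℕ} (X : Set (Fin n → ℝ)) : WithBot ℕ∞ :=
  ringKrullDim (MvPolynomial (Fin n) ℝ ⧸ vanishingIdealOf X)

/-- `x` is a regular (nonsingular) point of `X`: locally around `x`, `X` is the common zero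
set of `n - d` polynomials (`d = dim X`) whose gradients at `x` are linearly independent. -/
def IsRegularPoint {n : ℕ} (X : Set (Fin n → ℝ)) (x : Fin n → ℝ) : Prop :=
  x ∈ X ∧ ∃ d : ℕ, algDim X = (d : WithBot ℕ∞) ∧
    ∃ (p : Fin (n - d) → MvPolynomial (Fin n) ℝ) (U : Set (Fin n → ℝ)),
      IsOpen U ∧ x ∈ U ∧
      X ∩ U = {y ∈ U | ∀ j, MvPolynomial.eval y (p j) = 0} ∧
      LinearIndependent ℝ fun j : Fin (n - d) =>
        fun i : Fin n => MvPolynomial.eval x (MvPolynomial.pderiv i (p j))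

/-- `X` is central: it is the euclidean closure of its set of regular points. -/
def IsCentral {n : ℕ} (X : Set (Fin n → ℝ)) : Prop :=
  closure {x | IsRegularPoint X x} = X

/-- A semi-algebraic subset of `ℝᵐ`: a finite union of sets
`{x | p x = 0, q₁ x > 0, …, q_k x > 0}`. -/
def IsSemialgebraic {m : ℕ} (S : Set (Fin m → ℝ)) : Prop :=
  ∃ (N : ℕ) (P : Fin N → MvPolynomial (Fin m) ℝ) (k : Fin N → ℕ)
    (Q : (i : Fin N) → Fin (k i) → MvPolynomial (Fin m) ℝ),
    S = ⋃ i, {x | MvPolynomial.eval x (P i) = 0 ∧ ∀ j, 0 < MvPolynomial.eval x (Q i j)}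

/-- The graph of `f : X → ℝ`, as a subset of `ℝⁿ⁺¹`. -/
def graphOn {n : ℕ} (X : Set (Fin n → ℝ)) (f : (Fin n → ℝ) → ℝ) : Set (Fin (n + 1) → ℝ) :=
  {y | (fun i : Fin n => y i.castSucc) ∈ X ∧ y (Fin.last n) = f fun i : Fin n => y i.castSucc}

/-- `f` is a semi-algebraic function on `X`: its graph is semi-algebraic in `ℝⁿ⁺¹`. -/
def IsSemialgebraicFnOn {n : ℕ} (X : Set (Fin n → ℝ)) (f : (Fin n → ℝ) → ℝ) : Prop :=
  IsSemialgebraic (graphOn X f)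

/-- The interior of `S` in `X` for the euclidean topology of `X`. -/
def interiorIn {n : ℕ} (X S : Set (Fin n → ℝ)) : Set (Fin n → ℝ) :=
  {x ∈ X | ∃ U, IsOpen U ∧ x ∈ U ∧ U ∩ X ⊆ S}

/-- The euclidean boundary of `S` in `X`: closure of `S` in `X` minus interior of `S` in `X`. -/
def bdIn {n : ℕ} (X S : Set (Fin n → ℝ)) : Set (Fin n → ℝ) :=
  (closure S ∩ X) \ interiorIn X S

/-- The Zariski closure of `E` in `X`: the smallest real algebraic subset of `X`
containing `E`. -/
def zarClosureIn {n : ℕ} (X E : Set (Fin n → ℝ)) : Set (Fin n → ℝ) :=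
  ⋂₀ {V | IsZariskiClosedIn X V ∧ E ⊆ V}

/-- `V` is a regulous closed subset of `X`: the zero set of a regulous function on `X`. -/
def IsRegulousClosedIn {n : ℕ} (X V : Set (Fin n → ℝ)) : Prop :=
  ∃ f : (Fin n → ℝ) → ℝ, IsRegulousOn X f ∧ V = {x ∈ X | f x = 0}

/-- The regulous closure of `E` in `X`: the smallest regulous closed subset of `X`
containing `E`. -/
def regClosureIn {n : ℕ} (X E : Set (Fin n → ℝ)) : Set (Fin n → ℝ) :=
  ⋂₀ {V | IsRegulousClosedIn X V ∧ E ⊆ V}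

/-- `X` is an irreducible real algebraic set: it is not the union of two proper real
algebraic subsets. -/
def IsIrreducibleAlgSet {n : ℕ} (X : Set (Fin n → ℝ)) : Prop :=
  IsRealAlgebraicSet X ∧
    ∀ V W : Set (Fin n → ℝ), IsZariskiClosedIn X V → IsZariskiClosedIn X W →
      X = V ∪ W → V = X ∨ W = X

namespace SAx
open Filter Topology

lemma sign_const {g : ℝ → ℝ} (hg : Continuous g) {a b : ℝ}
    (h : ∀ w ∈ Set.uIcc a b, g w ≠ 0) : SignType.sign (g a) = SignType.sign (g b) := by
  have key := intermediate_value_uIcc (f := g) (a := a) (b := b) hg.continuousOn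
  have h0 : (0:ℝ) ∉ Set.uIcc (g a) (g b) := by
    intro h0
    obtain ⟨w, hw, hw0⟩ := key h0
    exact h w hw hw0
  have ha := h a Set.left_mem_uIcc
  have hb := h b Set.right_mem_uIcc
  rw [Set.mem_uIcc] at h0
  push Not at h0
  rcases lt_or_gt_of_ne ha with h1 | h1
  · have := h0.1 h1.le
    rw [sign_neg h1, sign_neg this]
  · have : 0 < g b := by
      by_contra hc
      have := h0.2 (not_lt.mp hc)
      linarith
    rw [sign_pos h1, sign_pos this]

/-- same component of the complement of `Z`. -/
def Same (Z : Finset ℝ) (t s : ℝ) : Prop := ∀ z ∈ Z, (z < t ↔ z < s) ∧ (t < z ↔ s < z)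

lemma Same.symm {Z : Finset ℝ} {t s : ℝ} (h : Same Z t s) : Same Z s t :=
  fun z hz => ⟨(h z hz).1.symm, (h z hz).2.symm⟩
lemma Same.trans {Z : Finset ℝ} {t s r : ℝ} (h : Same Z t s) (h' : Same Z s r) : Same Z t r :=
  fun z hz => ⟨(h z hz).1.trans (h' z hz).1, (h z hz).2.trans (h' z hz).2⟩

lemma Same.uIcc {Z : Finset ℝ} {t s r w : ℝ} (h : Same Z t s) (h' : Same Z t r)
    (hw : w ∈ Set.uIcc s r) : Same Z t w := by
  intro z hz
  have h1 := h z hz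
  have h2 := h' z hz
  rw [Set.mem_uIcc] at hw
  rcases hw with hw | hw <;> refine ⟨⟨fun h => ?_, fun h => ?_⟩, ⟨fun h => ?_, fun h => ?_⟩⟩
  · exact (h1.1.1 h).trans_le hw.1
  · exact h2.1.2 (h.trans_le hw.2)
  · exact hw.2.trans_lt (h2.2.1 h)
  · exact h1.2.2 (hw.1.trans_lt h)
  · exact (h2.1.1 h).trans_le hw.1
  · exact h1.1.2 (h.trans_le hw.2)
  · exact hw.2.trans_lt (h1.2.1 h)
  · exact h2.2.2 (hw.1.trans_lt h)

lemma Same.not_mem {Z : Finset ℝ} {t s : ℝ} (h : Same Z t s) (ht : t ∉ Z) : s ∉ Z := by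
  intro hs
  have h1 := h s hs
  simp only [lt_irrefl, iff_false, not_lt] at h1
  exact ht (by rwa [le_antisymm h1.2 h1.1] at hs)

lemma Same.of_fix {Z : Finset ℝ} (ψ : ℝ ≃o ℝ) (h : ∀ z ∈ Z, ψ z = z) (t : ℝ) : Same Z t (ψ t) := by
  intro z hz
  have := h z hz
  refine ⟨⟨fun h => ?_, fun h => ?_⟩, ⟨fun h => ?_, fun h => ?_⟩⟩
  · rw [← this]; exact ψ.lt_iff_lt.2 h
  · rw [← this] at h; exact ψ.lt_iff_lt.1 h
  · rw [← this]; exact ψ.lt_iff_lt.2 h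
  · rw [← this] at h; exact ψ.lt_iff_lt.1 h

/-- the interval around a point off Z -/
lemma exists_nbhd (Z : Finset ℝ) {t : ℝ} (ht : t ∉ Z) :
    ∃ a b, a < t ∧ t < b ∧ ∀ s ∈ Set.Icc a b, s ∉ Z := by
  have : (↑Z : Set ℝ)ᶜ ∈ 𝓝 t := (Z.finite_toSet.isClosed.isOpen_compl).mem_nhds (by simpa using ht)
  obtain ⟨ε, hε, hb⟩ := Metric.mem_nhds_iff.1 this
  refine ⟨t - ε/2, t + ε/2, by linarith, by linarith, fun s hs hz => ?_⟩
  have : s ∈ Metric.ball t ε := by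
    rw [Real.ball_eq_Ioo]; constructor <;> linarith [hs.1, hs.2]
  exact hb this hz

lemma same_of_uIcc {Z : Finset ℝ} {t s : ℝ} (h : ∀ w ∈ Set.uIcc t s, w ∉ Z) : Same Z t s := by
  intro z hz
  have : z ∉ Set.uIcc t s := fun hw => h z hw hz
  rw [Set.mem_uIcc] at this
  push Not at this
  refine ⟨⟨fun h => ?_, fun h => ?_⟩, ⟨fun h => ?_, fun h => ?_⟩⟩
  · by_contra hc; have := this.2 (not_lt.1 hc); linarith
  · by_contra hc; have := this.1 (not_lt.1 hc); linarith
  · by_contra hc; have := this.1 h.le; linarith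
  · by_contra hc; have := this.2 h.le; linarith

lemma pos_right (Z : Finset ℝ) (g h : ℝ → ℝ) (hh : Continuous h)
    (lim : Tendsto (fun t => |h t|) atTop atTop)
    (sZ : ∀ z ∈ Z, SignType.sign (g z) = SignType.sign (h z)) (t : ℝ) (ht : 0 < g t)
    (M : ∀ b, t < b → (∀ z ∈ Z, ¬ (t < z ∧ z < b)) →
      StrictMonoOn g (Set.Icc t b) ∧ StrictMonoOn h (Set.Icc t b)) :
    ∃ s, t ≤ s ∧ (∀ z ∈ Z, t < z → s < z) ∧ 0 < h s := by
  by_cases hex : ∃ z ∈ Z, t < z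
  · have hne : (Z.filter (fun z => t < z)).Nonempty := by
      obtain ⟨z, hz, h⟩ := hex; exact ⟨z, by simp [hz, h]⟩
    set u := (Z.filter (fun z => t < z)).min' hne with hu
    have hum : u ∈ Z.filter (fun z => t < z) := Finset.min'_mem _ hne
    rw [Finset.mem_filter] at hum
    have humin : ∀ z ∈ Z, t < z → u ≤ z := fun z hz h =>
      Finset.min'_le _ _ (by simp [hz, h])
    obtain ⟨M1, M2⟩ := M u hum.2 (fun z hz hc => by linarith [humin z hz hc.1])
    have hgu : 0 < g u := ht.trans (M1 ⟨le_rfl, hum.2.le⟩ ⟨hum.2.le, le_rfl⟩ hum.2)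
    have hhu : 0 < h u := by
      have := sZ u hum.1
      rw [sign_pos hgu] at this
      exact sign_eq_one_iff.1 this.symm
    have ev1 : ∀ᶠ s in 𝓝[<] u, 0 < h s :=
      (hh.tendsto u |>.eventually (lt_mem_nhds hhu)).filter_mono nhdsWithin_le_nhds
    have ev2 : ∀ᶠ s in 𝓝[<] u, s ∈ Set.Ioo t u := Ioo_mem_nhdsLT hum.2
    obtain ⟨s, hs1, hs2⟩ := (ev1.and ev2).exists
    exact ⟨s, hs2.1.le, fun z hz hz' => hs2.2.trans_le (humin z hz hz'), hs1⟩
  · push Not at hex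
    have ev1 := lim.eventually (eventually_gt_atTop (|h t|))
    obtain ⟨s, hs1, hs2⟩ := (ev1.and (eventually_gt_atTop t)).exists
    refine ⟨s, hs2.le, fun z hz h => by linarith [hex z hz], ?_⟩
    obtain ⟨M1, M2⟩ := M s hs2 (fun z hz hc => by linarith [hex z hz, hc.1])
    have : h t < h s := M2 ⟨le_rfl, hs2.le⟩ ⟨hs2.le, le_rfl⟩ hs2
    by_contra hc
    rw [abs_of_nonpos (not_lt.1 hc)] at hs1
    linarith [neg_abs_le (h t)]

/-- both functions strictly monotone in the same direction off `Z`. -/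
def Mon (Z : Finset ℝ) (g h : ℝ → ℝ) : Prop := ∀ a b, a < b → (∀ z ∈ Z, ¬ (a < z ∧ z < b)) →
  (StrictMonoOn g (Set.Icc a b) ∧ StrictMonoOn h (Set.Icc a b)) ∨
  (StrictAntiOn g (Set.Icc a b) ∧ StrictAntiOn h (Set.Icc a b))

lemma Mon.symm {Z g h} (H : Mon Z g h) : Mon Z h g := fun a b hab hz =>
  (H a b hab hz).imp And.symm And.symm

lemma Mon.neg {Z g h} (H : Mon Z g h) : Mon Z (-g) (-h) := fun a b hab hz =>
  (H a b hab hz).symm.imp (fun k => ⟨k.1.neg, k.2.neg⟩) (fun k => ⟨k.1.neg, k.2.neg⟩)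

lemma key_pos (Z : Finset ℝ) (g h : ℝ → ℝ) (hh : Continuous h)
    (lim : Tendsto (fun t => |h t|) atTop atTop) (lim' : Tendsto (fun t => |h t|) atBot atTop)
    (sZ : ∀ z ∈ Z, SignType.sign (g z) = SignType.sign (h z)) (M : Mon Z g h)
    (t : ℝ) (htZ : t ∉ Z) (ht : 0 < g t) :
    ∃ s, Same Z t s ∧ 0 < h s := by
  obtain ⟨a, b, hat, htb, hab⟩ := exists_nbhd Z htZ
  have hnab : ∀ z ∈ Z, ¬ (a < z ∧ z < b) := fun z hz hc => hab z ⟨hc.1.le, hc.2.le⟩ hz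
  rcases M a b (hat.trans htb) hnab with ⟨m1, m2⟩ | ⟨m1, m2⟩
  · obtain ⟨s, hs, hsz, hs0⟩ := pos_right Z g h hh lim sZ t ht (by
      intro b' hb' hz'
      have : ∀ z ∈ Z, ¬ (a < z ∧ z < b') := by
        rintro z hz ⟨h1, h2⟩
        rcases lt_or_ge t z with h3 | h3
        · exact hz' z hz ⟨h3, h2⟩
        · exact hab z ⟨h1.le, by linarith⟩ hz
      have hsub : Set.Icc t b' ⊆ Set.Icc a b' := Set.Icc_subset_Icc hat.le le_rfl
      rcases M a b' (hat.trans hb') this with ⟨k1, k2⟩ | ⟨k1, k2⟩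
      · exact ⟨k1.mono hsub, k2.mono hsub⟩
      · have e1 := m1 (a := a) (b := t) ⟨le_rfl, by linarith⟩ ⟨hat.le, htb.le⟩ hat
        have e2 := k1 (a := a) (b := t) ⟨le_rfl, by linarith⟩ ⟨hat.le, hb'.le⟩ hat
        linarith)
    refine ⟨s, fun z hz => ⟨⟨fun h => h.trans_le hs, fun h => ?_⟩, ⟨hsz z hz, fun h => hs.trans_lt h⟩⟩, hs0⟩
    rcases lt_trichotomy z t with h1 | h1 | h1
    · exact h1
    · exact absurd hz (h1 ▸ htZ)
    · linarith [hsz z hz h1]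
  · obtain ⟨s, hs, hsz, hs0⟩ := pos_right (Z.image Neg.neg) (fun t => g (-t)) (fun t => h (-t))
      (hh.comp continuous_neg) (lim'.comp tendsto_neg_atTop_atBot)
      (by intro z hz; obtain ⟨w, hw, rfl⟩ := Finset.mem_image.1 hz; simpa using sZ w hw)
      (-t) (by simpa using ht) (by
      intro b' hb' hz'
      have : ∀ z ∈ Z, ¬ (-b' < z ∧ z < b) := by
        rintro z hz ⟨h1, h2⟩
        rcases lt_or_ge z t with h3 | h3
        · exact hz' (-z) (Finset.mem_image_of_mem _ hz) ⟨by linarith, by linarith⟩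
        · exact hab z ⟨by linarith, h2.le⟩ hz
      rcases M (-b') b (by linarith) this with ⟨k1, k2⟩ | ⟨k1, k2⟩
      · have e1 := m1 (a := t) (b := b) ⟨hat.le, htb.le⟩ ⟨by linarith, le_rfl⟩ htb
        have e2 := k1 (a := t) (b := b) ⟨by linarith, htb.le⟩ ⟨by linarith, le_rfl⟩ htb
        linarith
      · refine ⟨fun u hu v hv huv => k1 ⟨?_, ?_⟩ ⟨?_, ?_⟩ (neg_lt_neg huv), fun u hu v hv huv => k2 ⟨?_, ?_⟩ ⟨?_, ?_⟩ (neg_lt_neg huv)⟩ <;> linarith [hu.1, hu.2, hv.1, hv.2])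
    have hs' : -s ≤ t := by linarith
    have hsz' : ∀ z ∈ Z, z < t → z < -s := by
      intro z hz hzt
      have := hsz (-z) (Finset.mem_image_of_mem _ hz) (by linarith)
      linarith
    refine ⟨-s, fun z hz => ⟨⟨hsz' z hz, fun h => h.trans_le hs'⟩, ⟨fun h => hs'.trans_lt h, fun h => ?_⟩⟩, hs0⟩
    rcases lt_trichotomy z t with h1 | h1 | h1
    · linarith [hsz' z hz h1]
    · exact absurd hz (h1 ▸ htZ)
    · exact h1

lemma key_neg (Z : Finset ℝ) (g h : ℝ → ℝ) (hh : Continuous h)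
    (lim : Tendsto (fun t => |h t|) atTop atTop) (lim' : Tendsto (fun t => |h t|) atBot atTop)
    (sZ : ∀ z ∈ Z, SignType.sign (g z) = SignType.sign (h z)) (M : Mon Z g h)
    (t : ℝ) (htZ : t ∉ Z) (ht : g t < 0) :
    ∃ s, Same Z t s ∧ h s < 0 := by
  obtain ⟨s, h1, h2⟩ := key_pos Z (-g) (-h) hh.neg (by simpa using lim) (by simpa using lim')
    (by intro z hz; simp [Left.sign_neg, sZ z hz]) M.neg t htZ (by simpa using ht)
  exact ⟨s, h1, by simpa using h2⟩

lemma key1 (Z : Finset ℝ) (g h : ℝ → ℝ) (hh : Continuous h)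
    (lim : Tendsto (fun t => |h t|) atTop atTop) (lim' : Tendsto (fun t => |h t|) atBot atTop)
    (sZ : ∀ z ∈ Z, SignType.sign (g z) = SignType.sign (h z)) (M : Mon Z g h)
    (t : ℝ) (htZ : t ∉ Z) :
    ∃ s, Same Z t s ∧ SignType.sign (g t) = SignType.sign (h s) := by
  rcases lt_trichotomy (g t) 0 with h0 | h0 | h0
  · obtain ⟨s, h1, h2⟩ := key_neg Z g h hh lim lim' sZ M t htZ h0
    exact ⟨s, h1, by rw [sign_neg h0, sign_neg h2]⟩
  · obtain ⟨a, b, hat, htb, hab⟩ := exists_nbhd Z htZ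
    have hnab : ∀ z ∈ Z, ¬ (a < z ∧ z < b) := fun z hz hc => hab z ⟨hc.1.le, hc.2.le⟩ hz
    have sa : Same Z t a := same_of_uIcc fun w hw => hab w (by
      rw [Set.uIcc_of_ge hat.le] at hw; exact ⟨hw.1, by linarith [hw.2]⟩)
    have sb : Same Z t b := same_of_uIcc fun w hw => hab w (by
      rw [Set.uIcc_of_le htb.le] at hw; exact ⟨by linarith [hw.1], hw.2⟩)
    have aZ := sa.not_mem htZ
    have bZ := sb.not_mem htZ
    have : ∃ u v, Same Z t u ∧ Same Z t v ∧ h u < 0 ∧ 0 < h v := by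
      rcases M a b (hat.trans htb) hnab with ⟨m1, m2⟩ | ⟨m1, m2⟩
      · have e1 := m1 (a := a) (b := t) ⟨le_rfl, by linarith⟩ ⟨hat.le, htb.le⟩ hat
        have e2 := m1 (a := t) (b := b) ⟨hat.le, htb.le⟩ ⟨by linarith, le_rfl⟩ htb
        obtain ⟨u, hu, hu'⟩ := key_neg Z g h hh lim lim' sZ M a aZ (by linarith)
        obtain ⟨v, hv, hv'⟩ := key_pos Z g h hh lim lim' sZ M b bZ (by linarith)
        exact ⟨u, v, sa.trans hu, sb.trans hv, hu', hv'⟩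
      · have e1 := m1 (a := a) (b := t) ⟨le_rfl, by linarith⟩ ⟨hat.le, htb.le⟩ hat
        have e2 := m1 (a := t) (b := b) ⟨hat.le, htb.le⟩ ⟨by linarith, le_rfl⟩ htb
        obtain ⟨u, hu, hu'⟩ := key_neg Z g h hh lim lim' sZ M b bZ (by linarith)
        obtain ⟨v, hv, hv'⟩ := key_pos Z g h hh lim lim' sZ M a aZ (by linarith)
        exact ⟨u, v, sb.trans hu, sa.trans hv, hu', hv'⟩
    obtain ⟨u, v, su, sv, hu, hv⟩ := this
    obtain ⟨s, hs, hs0⟩ := intermediate_value_uIcc (f := h) (a := u) (b := v) hh.continuousOn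
      (show (0:ℝ) ∈ _ from Set.mem_uIcc.2 (Or.inl ⟨hu.le, hv.le⟩))
    exact ⟨s, su.uIcc sv hs, by rw [h0, hs0]⟩
  · obtain ⟨s, h1, h2⟩ := key_pos Z g h hh lim lim' sZ M t htZ h0
    exact ⟨s, h1, by rw [sign_pos h0, sign_pos h2]⟩

/-- max and min of order isomorphisms -/
lemma iso_max (f g : ℝ ≃o ℝ) : ∃ k : ℝ ≃o ℝ, ∀ t, k t = max (f t) (g t) := by
  have sm : StrictMono (fun t => max (f t) (g t)) := fun a b hab =>
    max_lt_max (f.strictMono hab) (g.strictMono hab)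
  have sj : Function.Surjective (fun t => max (f t) (g t)) := by
    intro y
    refine ⟨min (f.symm y) (g.symm y), ?_⟩
    rcases le_total (f.symm y) (g.symm y) with h | h
    · simp only [min_eq_left h, OrderIso.apply_symm_apply]
      exact max_eq_left (by simpa using g.monotone h)
    · simp only [min_eq_right h, OrderIso.apply_symm_apply]
      exact max_eq_right (by simpa using f.monotone h)
  exact ⟨sm.orderIsoOfSurjective _ sj, fun t => rfl⟩

lemma iso_min (f g : ℝ ≃o ℝ) : ∃ k : ℝ ≃o ℝ, ∀ t, k t = min (f t) (g t) := by
  have sm : StrictMono (fun t => min (f t) (g t)) := fun a b hab =>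
    min_lt_min (f.strictMono hab) (g.strictMono hab)
  have sj : Function.Surjective (fun t => min (f t) (g t)) := by
    intro y
    refine ⟨max (f.symm y) (g.symm y), ?_⟩
    rcases le_total (f.symm y) (g.symm y) with h | h
    · simp only [max_eq_right h, OrderIso.apply_symm_apply]
      exact min_eq_right (by simpa using f.monotone h)
    · simp only [max_eq_left h, OrderIso.apply_symm_apply]
      exact min_eq_left (by simpa using g.monotone h)
  exact ⟨sm.orderIsoOfSurjective _ sj, fun t => rfl⟩

lemma iso_lin (m c d : ℝ) (hm : 0 < m) : ∃ k : ℝ ≃o ℝ, ∀ t, k t = d + m * (t - c) := by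
  have sm : StrictMono (fun t : ℝ => d + m * (t - c)) := fun a b hab => by
    have := mul_lt_mul_of_pos_left hab hm
    simp only; linarith
  have sj : Function.Surjective (fun t : ℝ => d + m * (t - c)) := by
    intro y
    refine ⟨(y - d) / m + c, ?_⟩
    field_simp
    ring
  exact ⟨sm.orderIsoOfSurjective _ sj, fun t => rfl⟩

lemma exists_iso_le (Z : Finset ℝ) (a b : ℝ) (hab : a ≤ b) (h : ∀ z ∈ Z, z < a ∨ b < z) :
    ∃ ψ : ℝ ≃o ℝ, (∀ z ∈ Z, ψ z = z) ∧ ψ a = b := by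
  have hl : ∃ l < a, ∀ z ∈ Z, z < a → z ≤ l := by
    by_cases hne : (Z.filter (fun z => z < a)).Nonempty
    · have := Finset.max'_mem _ hne
      rw [Finset.mem_filter] at this
      exact ⟨_, this.2, fun z hz hza => Finset.le_max' _ _ (by simp [hz, hza])⟩
    · rw [Finset.not_nonempty_iff_eq_empty, Finset.filter_eq_empty_iff] at hne
      exact ⟨a - 1, by linarith, fun z hz hza => absurd hza (hne hz)⟩
  have hu : ∃ u > b, ∀ z ∈ Z, b < z → u ≤ z := by
    by_cases hne : (Z.filter (fun z => b < z)).Nonempty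
    · have := Finset.min'_mem _ hne
      rw [Finset.mem_filter] at this
      exact ⟨_, this.2, fun z hz hza => Finset.min'_le _ _ (by simp [hz, hza])⟩
    · rw [Finset.not_nonempty_iff_eq_empty, Finset.filter_eq_empty_iff] at hne
      exact ⟨b + 1, by linarith, fun z hz hza => absurd hza (hne hz)⟩
  obtain ⟨l, hla, hl⟩ := hl
  obtain ⟨u, hbu, hu⟩ := hu
  obtain ⟨k1, e1⟩ := iso_lin ((b - l) / (a - l)) l l (div_pos (by linarith) (by linarith))
  obtain ⟨k2, e2⟩ := iso_lin ((u - b) / (u - a)) u u (div_pos (by linarith) (by linarith))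
  obtain ⟨k3, e3⟩ := iso_min k1 k2
  obtain ⟨k4, e4⟩ := iso_max (OrderIso.refl ℝ) k3
  have m1 : 1 ≤ (b - l) / (a - l) := by rw [le_div_iff₀ (by linarith)]; linarith
  have m2 : (u - b) / (u - a) ≤ 1 := by rw [div_le_iff₀ (by linarith)]; linarith
  refine ⟨k4, fun z hz => ?_, ?_⟩
  · rw [e4, e3]
    apply max_eq_left
    rcases h z hz with h | h
    · have := hl z hz h
      apply min_le_of_left_le
      rw [e1]; show _ ≤ z
      nlinarith
    · have := hu z hz h
      apply min_le_of_right_le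
      rw [e2]; show _ ≤ z
      nlinarith
  · have f1 : k1 a = b := by
      rw [e1, div_mul_cancel₀ _ (by linarith)]; ring
    have f2 : k2 a = b := by
      rw [e2, ← neg_sub u a, mul_neg, div_mul_cancel₀ _ (by linarith)]; ring
    rw [e4, e3, f1, f2, min_self]
    exact max_eq_right hab

lemma exists_iso (Z : Finset ℝ) (a b : ℝ) (ha : a ∉ Z) (h : Same Z a b) :
    ∃ ψ : ℝ ≃o ℝ, (∀ z ∈ Z, ψ z = z) ∧ ψ a = b := by
  have hb := h.not_mem ha
  rcases le_total a b with hab | hab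
  · refine exists_iso_le Z a b hab fun z hz => ?_
    rcases lt_trichotomy z a with h1 | h1 | h1
    · exact Or.inl h1
    · exact absurd hz (h1 ▸ ha)
    · exact Or.inr ((h z hz).2.1 h1)
  · obtain ⟨ψ, h1, h2⟩ := exists_iso_le Z b a hab fun z hz => by
      rcases lt_trichotomy z a with h1 | h1 | h1
      · exact Or.inl ((h z hz).1.1 h1)
      · exact absurd hz (h1 ▸ ha)
      · exact Or.inr h1
    exact ⟨ψ.symm, fun z hz => by rw [OrderIso.symm_apply_eq, h1 z hz], by
      rw [OrderIso.symm_apply_eq, h2]⟩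

lemma Mon.comp {Z g h} (H : Mon Z g h) (ψ : ℝ ≃o ℝ) (hψ : ∀ z ∈ Z, ψ z = z) :
    Mon Z g (h ∘ ψ) := by
  intro a b hab hz
  have hsa := Same.of_fix ψ hψ a
  have hsb := Same.of_fix ψ hψ b
  have := H (min a (ψ a)) (max b (ψ b)) (by simp [hab]) (by
    rintro z hzZ ⟨h1, h2⟩
    apply hz z hzZ
    constructor
    · rcases min_lt_iff.1 h1 with h | h
      · exact h
      · exact (hsa z hzZ).2.2 h
    · rcases lt_max_iff.1 h2 with h | h
      · exact h
      · exact (hsb z hzZ).1.2 h)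
  have s1 : Set.Icc a b ⊆ Set.Icc (min a (ψ a)) (max b (ψ b)) :=
    Set.Icc_subset_Icc (min_le_left _ _) (le_max_left _ _)
  have s2 : Set.MapsTo ψ (Set.Icc a b) (Set.Icc (min a (ψ a)) (max b (ψ b))) := fun t ht =>
    ⟨(min_le_right _ _).trans (ψ.monotone ht.1), (ψ.monotone ht.2).trans (le_max_right _ _)⟩
  rcases this with ⟨k1, k2⟩ | ⟨k1, k2⟩
  · exact Or.inl ⟨k1.mono s1, k2.comp (ψ.strictMono.strictMonoOn _) s2⟩
  · exact Or.inr ⟨k1.mono s1, k2.comp_strictMonoOn (ψ.strictMono.strictMonoOn _) s2⟩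

lemma match_iso (g : ℝ → ℝ) (hg : Continuous g)
    (gl : Tendsto (fun t => |g t|) atTop atTop) (gl' : Tendsto (fun t => |g t|) atBot atTop)
    (T : Finset ℝ) (hT : ∀ t, g t = 0 → t ∈ T) :
    ∀ (n : ℕ) (Z : Finset ℝ) (h : ℝ → ℝ), (T \ Z).card = n → Continuous h →
    Tendsto (fun t => |h t|) atTop atTop → Tendsto (fun t => |h t|) atBot atTop →
    (∀ z ∈ Z, SignType.sign (g z) = SignType.sign (h z)) → Mon Z g h →
    ∃ ψ : ℝ ≃o ℝ, (∀ z ∈ Z, ψ z = z) ∧ ∀ t, SignType.sign (g t) = SignType.sign (h (ψ t)) := by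
  intro n
  induction n using Nat.strong_induction_on with
  | _ n ih =>
  intro Z h hn hh hl hl' sZ M
  by_cases hex : ∃ c, g c = 0 ∧ c ∉ Z
  · obtain ⟨c, hc, hcZ⟩ := hex
    obtain ⟨s, hs, hs0⟩ := key1 Z g h hh hl hl' sZ M c hcZ
    obtain ⟨ψ, h1, h2⟩ := exists_iso Z c s hcZ hs
    obtain ⟨ψ', h3, h4⟩ := ih (T \ (insert c Z)).card (by
        rw [← hn]
        apply Finset.card_lt_card
        refine ⟨Finset.sdiff_subset_sdiff le_rfl (Finset.subset_insert _ _), fun hsub => ?_⟩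
        have := hsub (Finset.mem_sdiff.2 ⟨hT c hc, hcZ⟩)
        simp at this) (insert c Z) (h ∘ ψ) rfl (hh.comp ψ.continuous)
      (hl.comp ψ.tendsto_atTop) (hl'.comp ψ.tendsto_atBot) (by
        intro z hz
        rcases Finset.mem_insert.1 hz with rfl | hz
        · simpa [h2] using hs0
        · simpa [h1 z hz] using sZ z hz) (by
        intro a b hab hz
        exact M.comp ψ h1 a b hab fun z hzz => hz z (Finset.mem_insert_of_mem hzz))
    refine ⟨ψ'.trans ψ, fun z hz => ?_, h4⟩
    simp [h3 z (Finset.mem_insert_of_mem hz), h1 z hz]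
  · push Not at hex
    refine ⟨OrderIso.refl ℝ, fun _ _ => rfl, fun t => ?_⟩
    by_cases htZ : t ∈ Z
    · exact sZ t htZ
    obtain ⟨s, hs, hs0⟩ := key1 Z g h hh hl hl' sZ M t htZ
    rw [hs0]
    apply sign_const hh
    intro w hw hw0
    have hsw : Same Z t w := hs.uIcc (fun z hz => ⟨Iff.rfl, Iff.rfl⟩) hw
    obtain ⟨v, hv, hv0⟩ := key1 Z h g hg gl gl' (fun z hz => (sZ z hz).symm) M.symm w
      (hsw.not_mem htZ)
    rw [hw0, sign_zero, eq_comm, sign_eq_zero_iff] at hv0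
    exact (hsw.trans hv).not_mem htZ (hex v hv0)

/-- transfer of sign agreement along a modification fixing the roots -/
lemma transfer (Q Q' : ℝ → ℝ) (hQ' : Continuous Q') (Z : Finset ℝ)
    (hs : ∀ t, SignType.sign (Q t) = SignType.sign (Q' t)) (hZ : ∀ t, Q t = 0 → t ∈ Z)
    (ψ : ℝ ≃o ℝ) (hψ : ∀ z ∈ Z, ψ z = z) (t : ℝ) :
    SignType.sign (Q t) = SignType.sign (Q' (ψ t)) := by
  by_cases ht : t ∈ Z
  · rw [hψ t ht, hs]
  rw [hs]
  apply sign_const hQ'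
  intro w hw hw0
  have hsw : Same Z t w := Same.uIcc (fun z hz => ⟨Iff.rfl, Iff.rfl⟩) (Same.of_fix ψ hψ t) hw
  apply hsw.not_mem ht
  apply hZ
  have := hs w
  rwa [hw0, sign_zero, sign_eq_zero_iff] at this

end SAx
namespace SAx
open Polynomial in
lemma pseudo_div {A : Type*} [CommRing A] (q : A[X]) (i : ℕ) (hi : 1 ≤ i) (hq : q.natDegree ≤ i) :
    ∀ (m : ℕ) (p : A[X]), p.natDegree ≤ m →
      ∃ (k : ℕ) (a r : A[X]), Polynomial.C (q.coeff i) ^ k * p = a * q + r ∧ r.natDegree < i := by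
  intro m
  induction m with
  | zero => exact fun p hp => ⟨0, 0, p, by simp, by omega⟩
  | succ m ih =>
    intro p hp
    by_cases hpi : p.natDegree < i
    · exact ⟨0, 0, p, by simp, hpi⟩
    have him : i ≤ m + 1 := by omega
    obtain ⟨k, a, r, h1, h2⟩ := ih (Polynomial.C (q.coeff i) * p - Polynomial.C (p.coeff (m+1)) * Polynomial.X ^ (m + 1 - i) * q) (by
      rw [natDegree_le_iff_coeff_eq_zero]
      intro N hN
      rw [mul_assoc, Polynomial.coeff_sub, Polynomial.coeff_C_mul, Polynomial.coeff_C_mul, coeff_X_pow_mul', if_pos (by omega)]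
      rcases Nat.lt_or_ge (m+1) N with h | h
      · rw [coeff_eq_zero_of_natDegree_lt (by omega : p.natDegree < N),
          coeff_eq_zero_of_natDegree_lt (by omega : q.natDegree < N - (m + 1 - i))]; simp
      · have : N = m + 1 := by omega
        subst this
        rw [show m + 1 - (m + 1 - i) = i by omega]; ring)
    refine ⟨k + 1, a + Polynomial.C (q.coeff i) ^ k * (Polynomial.C (p.coeff (m+1)) * Polynomial.X ^ (m + 1 - i)), r, ?_, h2⟩
    linear_combination h1

variable {V A : Type*} [CommRing A] (ev : V → A →+* ℝ)

open Polynomial in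
lemma exists_rem (p q : A[X]) (i : ℕ) (hi : 1 ≤ i) :
    ∃ r : A[X], r.natDegree < i ∧ ∀ x t, (∀ j, i < j → ev x (q.coeff j) = 0) →
      ev x (q.coeff i) ≠ 0 → (q.map (ev x)).eval t = 0 →
      SignType.sign ((p.map (ev x)).eval t) = SignType.sign ((r.map (ev x)).eval t) := by
  set q' : A[X] := ∑ j ∈ Finset.range (i+1), monomial j (q.coeff j) with hq'
  have hc : ∀ j, q'.coeff j = if j < i + 1 then q.coeff j else 0 := by
    intro j
    simp [hq', Polynomial.coeff_monomial]
  have hd : q'.natDegree ≤ i := by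
    rw [natDegree_le_iff_coeff_eq_zero]
    intro N hN
    rw [hc, if_neg (by omega)]
  obtain ⟨k, a, r, h1, h2⟩ := pseudo_div q' i hi hd p.natDegree p le_rfl
  refine ⟨Polynomial.C (q'.coeff i) ^ k * r, ?_, ?_⟩
  · rw [← Polynomial.C_pow]
    exact (natDegree_C_mul_le _ _).trans_lt h2
  · intro x t hj hne h0
    have hqq : q'.map (ev x) = q.map (ev x) := by
      ext j
      simp only [Polynomial.coeff_map, hc]
      split_ifs with h
      · rfl
      · rw [map_zero, hj j (by omega)]
    have h3 := congrArg (fun P : A[X] => (P.map (ev x)).eval t) h1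
    simp only [Polynomial.map_mul, Polynomial.map_pow, Polynomial.map_add, Polynomial.map_C, Polynomial.eval_mul,
      Polynomial.eval_pow, Polynomial.eval_C, Polynomial.eval_add, hqq, h0, mul_zero, zero_add] at h3
    simp only [Polynomial.map_mul, Polynomial.map_pow, Polynomial.map_C, Polynomial.eval_mul, Polynomial.eval_pow, Polynomial.eval_C]
    rw [← h3]
    have hci : q'.coeff i = q.coeff i := by rw [hc, if_pos (by omega)]
    rw [hci, ← mul_assoc, sign_mul, ← pow_add, sign_pos (a := _ ^ (k + k)), one_mul]
    exact (Even.add_self k).pow_pos hne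

open Polynomial in
/-- The sign diagrams of the polynomials in `F` at `x` and `y` agree. -/
def Compat (F : Finset A[X]) (x y : V) (φ : ℝ ≃o ℝ) : Prop :=
  ∀ p ∈ F, ∀ t, SignType.sign ((p.map (ev x)).eval t) = SignType.sign ((p.map (ev y)).eval (φ t))

def SameSign (G : Finset A) (x y : V) : Prop :=
  ∀ g ∈ G, SignType.sign (ev x g) = SignType.sign (ev y g)

open Polynomial in
lemma real_step (P P' : ℝ[X]) (φ : ℝ ≃o ℝ) (Z : Finset ℝ) 
    (hd : ∀ t, SignType.sign (P.derivative.eval t) = SignType.sign (P'.derivative.eval (φ t)))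
    (hZ : ∀ t, P.derivative.eval t = 0 → t ∈ Z)
    (sZ : ∀ z ∈ Z, SignType.sign (P.eval z) = SignType.sign (P'.eval (φ z))) :
    ∃ ψ : ℝ ≃o ℝ, (∀ z ∈ Z, ψ z = z) ∧
      ∀ t, SignType.sign (P.eval t) = SignType.sign (P'.eval (φ (ψ t))) := by
  obtain ⟨t0, ht0⟩ := Z.exists_notMem
  have hd0 : P.derivative ≠ 0 := fun h => ht0 (hZ t0 (by simp [h]))
  have hd0' : P'.derivative ≠ 0 := fun h => ht0 (hZ t0 (by
    have := hd t0; rw [h, Polynomial.eval_zero, sign_zero, sign_eq_zero_iff] at this; exact this))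
  have hdeg : ∀ {R : ℝ[X]}, R.derivative ≠ 0 → 0 < R.degree := by
    intro R hR
    rw [← natDegree_pos_iff_degree_pos]
    by_contra hc
    apply hR
    rw [eq_C_of_natDegree_eq_zero (by omega : R.natDegree = 0), derivative_C]
  have hP0 : P ≠ 0 := fun h => hd0 (by simp [h])
  have l1 : Filter.Tendsto (fun t : ℝ => ‖t‖) Filter.atTop Filter.atTop := tendsto_norm_atTop_atTop
  have l2 : Filter.Tendsto (fun t : ℝ => ‖t‖) Filter.atBot Filter.atTop := Filter.tendsto_abs_atBot_atTop
  refine match_iso (fun t => P.eval t) P.continuous (P.tendsto_norm_atTop (hdeg hd0) l1)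
    (P.tendsto_norm_atTop (hdeg hd0) l2) P.roots.toFinset (by
      intro t ht; simp [hP0, ht]) _ Z (fun t => P'.eval (φ t)) rfl (P'.continuous.comp φ.continuous)
    (P'.tendsto_norm_atTop (hdeg hd0') (l1.comp φ.tendsto_atTop))
    (P'.tendsto_norm_atTop (hdeg hd0') (l2.comp φ.tendsto_atBot)) sZ ?_
  intro a b hab hz
  have hconst : ∀ u ∈ Set.Ioo a b, ∀ v ∈ Set.Ioo a b,
      SignType.sign (P.derivative.eval u) = SignType.sign (P.derivative.eval v) := by
    intro u hu v hv
    apply sign_const P.derivative.continuous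
    intro w hw hw0
    have : w ∈ Set.Ioo a b := Set.ordConnected_Ioo.uIcc_subset hu hv hw
    exact hz w (hZ w hw0) this
  have hm : (a + b) / 2 ∈ Set.Ioo a b := ⟨by linarith, by linarith⟩
  have hm0 : P.derivative.eval ((a+b)/2) ≠ 0 := fun h0 => hz _ (hZ _ h0) hm
  have hsub : ∀ w ∈ Set.Ioo (φ a) (φ b), φ.symm w ∈ Set.Ioo a b := fun w hw =>
    ⟨by rw [OrderIso.lt_symm_apply]; exact hw.1, by rw [OrderIso.symm_apply_lt]; exact hw.2⟩
  have hmaps : Set.MapsTo φ (Set.Icc a b) (Set.Icc (φ a) (φ b)) := fun t ht =>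
    ⟨φ.monotone ht.1, φ.monotone ht.2⟩
  rcases lt_or_gt_of_ne hm0 with h0 | h0
  · have hs : ∀ u ∈ Set.Ioo a b, P.derivative.eval u < 0 := fun u hu => by
      rw [← sign_eq_neg_one_iff, hconst u hu _ hm, sign_neg h0]
    have hs' : ∀ u ∈ Set.Ioo (φ a) (φ b), P'.derivative.eval u < 0 := fun u hu => by
      have := hd (φ.symm u)
      rw [φ.apply_symm_apply, sign_neg (hs _ (hsub u hu))] at this
      exact sign_eq_neg_one_iff.1 this.symm
    right
    constructor
    · apply strictAntiOn_of_deriv_neg (convex_Icc a b) P.continuousOn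
      intro u hu; rw [interior_Icc] at hu; rw [Polynomial.deriv]; exact hs u hu
    · refine StrictAntiOn.comp_strictMonoOn ?_ (φ.strictMono.strictMonoOn _) hmaps (g := fun t => P'.eval t)
      apply strictAntiOn_of_deriv_neg (convex_Icc _ _) P'.continuousOn
      intro u hu; rw [interior_Icc] at hu; rw [Polynomial.deriv]; exact hs' u hu
  · have hs : ∀ u ∈ Set.Ioo a b, 0 < P.derivative.eval u := fun u hu => by
      rw [← sign_eq_one_iff, hconst u hu _ hm, sign_pos h0]
    have hs' : ∀ u ∈ Set.Ioo (φ a) (φ b), 0 < P'.derivative.eval u := fun u hu => by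
      have := hd (φ.symm u)
      rw [φ.apply_symm_apply, sign_pos (hs _ (hsub u hu))] at this
      exact sign_eq_one_iff.1 this.symm
    left
    constructor
    · apply strictMonoOn_of_deriv_pos (convex_Icc a b) P.continuousOn
      intro u hu; rw [interior_Icc] at hu; rw [Polynomial.deriv]; exact hs u hu
    · refine StrictMonoOn.comp ?_ (φ.strictMono.strictMonoOn _) hmaps (g := fun t => P'.eval t)
      apply strictMonoOn_of_deriv_pos (convex_Icc _ _) P'.continuousOn
      intro u hu; rw [interior_Icc] at hu; rw [Polynomial.deriv]; exact hs' u hu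

open Polynomial in
open Classical in
lemma step_aux (n : ℕ) (hn : 1 ≤ n)
    (ih : ∀ F : Finset A[X], (∀ p ∈ F, p.natDegree < n) →
      ∃ G : Finset A, ∀ x y, SameSign ev G x y → ∃ φ, Compat ev F x y φ) :
    ∀ E : Finset A[X], (∀ p ∈ E, p.natDegree ≤ n) → ∀ F : Finset A[X], (∀ p ∈ F, p.natDegree < n) →
      ∃ G : Finset A, ∀ x y, SameSign ev G x y → ∃ φ, Compat ev (E ∪ F) x y φ := by
  intro E
  induction E using Finset.induction_on with
  | empty => intro _ F hF; simpa using ih F hF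
  | insert p E hpE ihE =>
    intro hE F hF
    have hp : p.natDegree ≤ n := hE p (Finset.mem_insert_self _ _)
    have hE0 : ∀ q ∈ E, q.natDegree ≤ n := fun q hq => hE q (Finset.mem_insert_of_mem hq)
    choose! r hr1 hr2 using fun (q : A[X]) (i : ℕ) (hi : 1 ≤ i) => exists_rem ev p q i hi
    set D : Finset A[X] := E ∪ insert (derivative p) F with hD
    have hDn : ∀ q ∈ D, q.natDegree ≤ n := by
      intro q hq
      simp only [hD, Finset.mem_union, Finset.mem_insert] at hq
      rcases hq with hq | rfl | hq
      · exact hE0 q hq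
      · exact (natDegree_derivative_le p).trans (by omega)
      · exact (hF q hq).le
    set R : Finset A[X] := (D ×ˢ Finset.Icc 1 n).image (fun a => r a.1 a.2) with hR
    obtain ⟨G, hG⟩ := ihE hE0 (insert (derivative p) F ∪ R) (by
      intro q hq
      simp only [Finset.mem_union, Finset.mem_insert] at hq
      rcases hq with (rfl | hq) | hq
      · exact (natDegree_derivative_le p).trans_lt (by omega)
      · exact hF q hq
      · simp only [hR, Finset.mem_image, Finset.mem_product, Finset.mem_Icc] at hq
        obtain ⟨a, ha, rfl⟩ := hq
        exact (hr1 a.1 a.2 ha.2.1).trans_le ha.2.2)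
    refine ⟨G ∪ insert (p.coeff 0) ((D ×ˢ Finset.range (n+1)).image fun a => a.1.coeff a.2), ?_⟩
    intro x y hxy
    obtain ⟨φ, hφ⟩ := hG x y (fun g hg => hxy g (Finset.mem_union_left _ hg))
    have hc0 := hxy (p.coeff 0) (by simp)
    have hco : ∀ q ∈ D, ∀ j, SignType.sign (ev x (q.coeff j)) = SignType.sign (ev y (q.coeff j)) := by
      intro q hq j
      rcases Nat.lt_or_ge n j with h | h
      · rw [coeff_eq_zero_of_natDegree_lt ((hDn q hq).trans_lt h)]; simp
      · apply hxy
        apply Finset.mem_union_right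
        apply Finset.mem_insert_of_mem
        exact Finset.mem_image.2 ⟨(q, j), by simp [hq]; omega, rfl⟩
    have hDφ : ∀ q ∈ D, ∀ t, SignType.sign ((q.map (ev x)).eval t)
        = SignType.sign ((q.map (ev y)).eval (φ t)) := by
      intro q hq
      apply hφ
      simp only [hD, Finset.mem_union, Finset.mem_insert] at hq ⊢
      tauto
    have hpD : derivative p ∈ D := by simp [hD]
    have hdφ := hDφ _ hpD
    simp only [← derivative_map] at hdφ
    -- suffices to find ψ
    suffices hs : ∃ φ' : ℝ ≃o ℝ, (∀ q ∈ D, ∀ t, SignType.sign ((q.map (ev x)).eval t)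
        = SignType.sign ((q.map (ev y)).eval (φ' t))) ∧ ∀ t, SignType.sign ((p.map (ev x)).eval t)
        = SignType.sign ((p.map (ev y)).eval (φ' t)) by
      obtain ⟨φ', h1, h2⟩ := hs
      refine ⟨φ', fun q hq => ?_⟩
      simp only [Finset.mem_union, Finset.mem_insert] at hq
      rcases hq with (rfl | hq) | hq
      · exact h2
      · exact h1 q (by simp [hD, hq])
      · exact h1 q (by simp [hD, hq])
    by_cases hd0 : derivative (p.map (ev x)) = 0
    · have hd0' : derivative (p.map (ev y)) = 0 := by
        apply Polynomial.funext
        intro t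
        have := hdφ (φ.symm t)
        rw [hd0, Polynomial.eval_zero, sign_zero, φ.apply_symm_apply, eq_comm, sign_eq_zero_iff] at this
        simpa using this
      refine ⟨φ, hDφ, fun t => ?_⟩
      rw [eq_C_of_natDegree_eq_zero (derivative_eq_zero.1 hd0),
        eq_C_of_natDegree_eq_zero (derivative_eq_zero.1 hd0')]
      simpa using hc0
    set Z : Finset ℝ := D.biUnion (fun q => (q.map (ev x)).roots.toFinset) with hZ
    have hZm : ∀ q ∈ D, q.map (ev x) ≠ 0 → ∀ t, (q.map (ev x)).eval t = 0 → t ∈ Z := by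
      intro q hq hq0 t ht
      rw [hZ, Finset.mem_biUnion]
      exact ⟨q, hq, by simp [hq0, ht]⟩
    obtain ⟨ψ, hψ1, hψ2⟩ := real_step (p.map (ev x)) (p.map (ev y)) φ Z hdφ (by
        intro t ht
        apply hZm _ hpD
        · rwa [← derivative_map]
        · rwa [← derivative_map]) (by
        intro z hz
        rw [hZ, Finset.mem_biUnion] at hz
        obtain ⟨q, hq, hz⟩ := hz
        rw [Multiset.mem_toFinset, mem_roots'] at hz
        obtain ⟨hq0, hz⟩ := hz
        have hz : (q.map (ev x)).eval z = 0 := hz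
        set i := (q.map (ev x)).natDegree with hi
        have hi1 : 1 ≤ i := by
          by_contra hc
          have h0 : (q.map (ev x)).natDegree = 0 := by omega
          rw [eq_C_of_natDegree_eq_zero h0] at hz hq0
          simp at hz hq0
          exact hq0 hz
        have hin : i ≤ n := natDegree_map_le.trans (hDn q hq)
        have hx1 : ∀ j, i < j → ev x (q.coeff j) = 0 := by
          intro j hj
          rw [← Polynomial.coeff_map]
          exact coeff_eq_zero_of_natDegree_lt hj
        have hx2 : ev x (q.coeff i) ≠ 0 := by
          rw [← Polynomial.coeff_map]
          exact leadingCoeff_ne_zero.2 hq0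
        have hy1 : ∀ j, i < j → ev y (q.coeff j) = 0 := by
          intro j hj
          have := hco q hq j
          rwa [hx1 j hj, sign_zero, eq_comm, sign_eq_zero_iff] at this
        have hy2 : ev y (q.coeff i) ≠ 0 := by
          intro h0
          have := hco q hq i
          rw [h0, sign_zero, sign_eq_zero_iff] at this
          exact hx2 this
        have hyz : (q.map (ev y)).eval (φ z) = 0 := by
          have := hDφ q hq z
          rwa [hz, sign_zero, eq_comm, sign_eq_zero_iff] at this
        rw [hr2 q i hi1 x z hx1 hx2 hz, hr2 q i hi1 y (φ z) hy1 hy2 hyz]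
        apply hφ
        apply Finset.mem_union_right
        apply Finset.mem_union_right
        exact Finset.mem_image.2 ⟨(q, i), by simp [hq]; omega, rfl⟩)
    refine ⟨ψ.trans φ, fun q hq t => ?_, hψ2⟩
    by_cases hq0 : q.map (ev x) = 0
    · have := hDφ q hq (ψ t)
      rw [OrderIso.trans_apply, ← this, hq0]
      simp
    · exact transfer (fun t => (q.map (ev x)).eval t) (fun t => (q.map (ev y)).eval (φ t))
        ((q.map (ev y)).continuous.comp φ.continuous) Z (hDφ q hq) (hZm q hq hq0) ψ hψ1 t

open Polynomial in
lemma main_elim (F : Finset A[X]) :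
    ∃ G : Finset A, ∀ x y, SameSign ev G x y → ∃ φ, Compat ev F x y φ := by
  classical
  have key : ∀ n : ℕ, ∀ F : Finset A[X], (∀ p ∈ F, p.natDegree < n + 1) →
      ∃ G : Finset A, ∀ x y, SameSign ev G x y → ∃ φ, Compat ev F x y φ := by
    intro n
    induction n with
    | zero =>
      intro F hF
      refine ⟨F.image fun p => p.coeff 0, fun x y h => ⟨OrderIso.refl ℝ, fun p hp t => ?_⟩⟩
      have := h (p.coeff 0) (Finset.mem_image_of_mem _ hp)
      rw [eq_C_of_natDegree_eq_zero (by have := hF p hp; omega : p.natDegree = 0)]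
      simpa using this
    | succ n ih =>
      intro F hF
      simpa using step_aux ev (n+1) (by omega) ih F (fun p hp => by have := hF p hp; omega) ∅ (by simp)
  exact key (F.sup natDegree) F fun p hp => Nat.lt_succ_of_le (Finset.le_sup (f := natDegree) hp)

end SAx

namespace SAx
open MvPolynomial

/-- `S` is a union of sign classes of a finite family of polynomials. -/
def Q {σ : Type*} (S : Set (σ → ℝ)) : Prop :=
  ∃ G : Finset (MvPolynomial σ ℝ), ∀ x y, SameSign (fun x => eval x) G x y → (x ∈ S → y ∈ S)

variable {σ τ : Type*}

lemma Q.compl {S : Set (σ → ℝ)} (h : Q S) : Q Sᶜ := by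
  obtain ⟨G, hG⟩ := h
  exact ⟨G, fun x y hxy hx hy => hx (hG y x (fun g hg => (hxy g hg).symm) hy)⟩

lemma Q.inter {S T : Set (σ → ℝ)} (h : Q S) (h' : Q T) : Q (S ∩ T) := by
  classical
  obtain ⟨G, hG⟩ := h
  obtain ⟨G', hG'⟩ := h'
  exact ⟨G ∪ G', fun x y hxy hx => ⟨hG x y (fun g hg => hxy g (Finset.mem_union_left _ hg)) hx.1,
    hG' x y (fun g hg => hxy g (Finset.mem_union_right _ hg)) hx.2⟩⟩

lemma Q.union {S T : Set (σ → ℝ)} (h : Q S) (h' : Q T) : Q (S ∪ T) := by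
  have := (h.compl.inter h'.compl).compl
  rwa [Set.compl_inter, compl_compl, compl_compl] at this

lemma Q.pos (p : MvPolynomial σ ℝ) : Q {x | 0 < eval x p} :=
  ⟨{p}, fun x y hxy hx => by
    have := hxy p (by simp)
    rw [Set.mem_ofPred_eq] at hx ⊢
    rw [sign_pos hx] at this
    exact sign_eq_one_iff.1 this.symm⟩

lemma Q.zero (p : MvPolynomial σ ℝ) : Q {x | eval x p = 0} :=
  ⟨{p}, fun x y hxy hx => by
    have := hxy p (by simp)
    rw [Set.mem_ofPred_eq] at hx ⊢
    rw [hx, sign_zero] at this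
    exact sign_eq_zero_iff.1 this.symm⟩

lemma Q.iInter {ι : Type*} [Finite ι] {S : ι → Set (σ → ℝ)} (h : ∀ i, Q (S i)) : Q (⋂ i, S i) := by
  classical
  cases nonempty_fintype ι
  choose G hG using h
  refine ⟨Finset.univ.biUnion G, fun x y hxy hx => Set.mem_iInter.2 fun i => ?_⟩
  exact hG i x y (fun g hg => hxy g (Finset.mem_biUnion.2 ⟨i, Finset.mem_univ _, hg⟩))
    (Set.mem_iInter.1 hx i)

lemma Q.preimage {S : Set (σ → ℝ)} (h : Q S) (F : σ → MvPolynomial τ ℝ) :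
    Q {y : τ → ℝ | (fun i => eval y (F i)) ∈ S} := by
  classical
  obtain ⟨G, hG⟩ := h
  refine ⟨G.image (bind₁ F), fun x y hxy => hG _ _ fun g hg => ?_⟩
  have := hxy _ (Finset.mem_image_of_mem _ hg)
  have e : ∀ x : τ → ℝ, eval x (bind₁ F g) = eval (fun i => eval x (F i)) g := by
    intro x
    exact eval₂Hom_bind₁ (RingHom.id ℝ) x F g
  rwa [e, e] at this

open Classical in
lemma Q.proj {S : Set (σ → ℝ)} (h : Q S) (i : σ) :
    Q {x : σ → ℝ | ∃ t, Function.update x i t ∈ S} := by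
  obtain ⟨G, hG⟩ := h
  let L : MvPolynomial σ ℝ →ₐ[ℝ] Polynomial (MvPolynomial σ ℝ) :=
    aeval (fun j => if j = i then Polynomial.X else Polynomial.C (X j))
  have e : ∀ (x : σ → ℝ) (t : ℝ) (p : MvPolynomial σ ℝ),
      ((L p).map (eval x)).eval t = eval (Function.update x i t) p := by
    intro x t p
    induction p using MvPolynomial.induction_on with
    | C a => simp [L, IsScalarTower.algebraMap_apply ℝ (MvPolynomial σ ℝ) (Polynomial (MvPolynomial σ ℝ)), MvPolynomial.algebraMap_eq]
    | add p q hp hq => simp [hp, hq]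
    | mul_X p j hp =>
      rw [map_mul, Polynomial.map_mul, Polynomial.eval_mul, hp]
      by_cases hj : j = i
      · subst hj; simp [L]
      · simp [L, hj]
  obtain ⟨G', hG'⟩ := main_elim (fun x : σ → ℝ => eval x) (G.image L)
  refine ⟨G', fun x y hxy ⟨t, ht⟩ => ?_⟩
  obtain ⟨φ, hφ⟩ := hG' x y hxy
  refine ⟨φ t, hG _ _ (fun g hg => ?_) ht⟩
  have := hφ (L g) (Finset.mem_image_of_mem _ hg) t
  rwa [e, e] at this

lemma Q.projs {S : Set (σ → ℝ)} (h : Q S) (T : Finset σ) :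
    Q {x : σ → ℝ | ∃ z : σ → ℝ, (∀ i, i ∉ T → z i = x i) ∧ z ∈ S} := by
  classical
  induction T using Finset.induction_on with
  | empty =>
    convert h using 1
    ext x
    constructor
    · rintro ⟨z, h1, h2⟩
      have : z = x := funext fun i => h1 i (by simp)
      exact this ▸ h2
    · exact fun hx => ⟨x, fun _ _ => rfl, hx⟩
  | insert i T hi ih =>
    convert ih.proj i using 1
    ext x
    constructor
    · rintro ⟨z, h1, h2⟩
      refine ⟨z i, z, fun j hj => ?_, h2⟩
      by_cases hji : j = i
      · subst hji; simp
      · simp only [ne_eq, hji, not_false_eq_true, Function.update_of_ne]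
        exact h1 j (by simp [hji, hj])
    · rintro ⟨t, z, h1, h2⟩
      refine ⟨z, fun j hj => ?_, h2⟩
      simp only [Finset.mem_insert, not_or] at hj
      rw [h1 j hj.2, Function.update_of_ne hj.1]

lemma Q.closure [Fintype σ] {S : Set (σ → ℝ)} (h : Q S) : Q (closure S) := by
  classical
  -- variables: y, z, ε
  let B : Set (σ ⊕ (σ ⊕ Unit) → ℝ) :=
    {x | (fun i => eval x (X (Sum.inr (Sum.inl i)))) ∈ S} ∩
      ⋂ i : σ, {x | 0 < eval x (X (Sum.inr (Sum.inr ())) - (X (Sum.inl i) - X (Sum.inr (Sum.inl i))) ^ 2)}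
  have hB : Q B := (h.preimage _).inter (Q.iInter fun i => Q.pos _)
  have hB1 := hB.projs (Finset.univ.image (fun i : σ => Sum.inr (Sum.inl i)))
  have hB2 := ((Q.pos (X (Sum.inr (Sum.inr ())) : MvPolynomial (σ ⊕ (σ ⊕ Unit)) ℝ)).inter hB1.compl).proj
    (Sum.inr (Sum.inr ()))
  have hB3 := hB2.compl.preimage (τ := σ) (Sum.elim (fun i => X i) (fun _ => 0))
  convert hB3 using 1
  ext y
  rw [Metric.mem_closure_iff]
  constructor
  · rintro H ⟨ε, hε, hn⟩
    apply hn
    have hε : 0 < ε := by simpa using hε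
    obtain ⟨w, hw, hd⟩ := H (Real.sqrt ε) (Real.sqrt_pos.2 hε)
    refine ⟨Sum.elim y (Sum.elim w fun _ => ε), ?_, ?_⟩
    · rintro (i | i | i) hi
      · simp
      · simp at hi
      · simp
    · refine ⟨by simpa using hw, Set.mem_iInter.2 fun i => ?_⟩
      have h1 : |y i - w i| < Real.sqrt ε := (dist_le_pi_dist y w i).trans_lt hd
      have h2 : (y i - w i)^2 < ε := by
        rw [← sq_abs]
        calc _ < (Real.sqrt ε)^2 := by gcongr
          _ = ε := Real.sq_sqrt hε.le
      simpa using h2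
  · intro H ε hε
    by_contra hc
    apply H
    refine ⟨ε^2, by simpa using pow_pos hε 2, ?_⟩
    rintro ⟨z, h1, h2, h3⟩
    apply hc
    refine ⟨_, h2, ?_⟩
    rw [dist_pi_lt_iff hε]
    intro i
    have h4 := Set.mem_iInter.1 h3 i
    have e1 := h1 (Sum.inl i) (by simp)
    have e2 := h1 (Sum.inr (Sum.inr ())) (by simp)
    simp at e1 e2 h4
    rw [e1, e2] at h4
    rw [Real.dist_eq]
    simpa using abs_lt_of_sq_lt_sq h4 hε.le

end SAx
namespace SAx

lemma dim_le_of_integral {R S : Type} [CommRing R] [CommRing S] [IsDomain S] (g : R →+* S)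
    (hg : Function.Injective g) (hi : g.IsIntegral) : ringKrullDim R ≤ ringKrullDim S := by
  algebraize [g]
  refine iSup_le fun l => ?_
  have : Algebra.IsIntegral R S := ⟨hi⟩
  obtain ⟨P, hP, hP2⟩ := Ideal.exists_ideal_over_prime_of_isIntegral_of_isDomain (S := S)
    (l.head.asIdeal) (by
      have : RingHom.ker (algebraMap R S) = ⊥ := (RingHom.injective_iff_ker_eq_bot _).1 hg
      rw [this]; exact bot_le)
  have : P.LiesOver l.head.asIdeal := ⟨hP2.symm⟩
  obtain ⟨L, hL, -⟩ := Ideal.exists_ltSeries_of_hasGoingUp l P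
  rw [← hL]
  exact le_iSup (fun l : LTSeries (PrimeSpectrum S) => (l.length : WithBot ℕ∞)) L

lemma trdeg_of_integral {R S : Type} [CommRing R] [CommRing S] [IsDomain S] [Algebra ℝ R] [Algebra ℝ S] 
    [IsDomain R]
    (g : R →ₐ[ℝ] S)
    (hg : Function.Injective g) (hi : g.IsIntegral) : Algebra.trdeg ℝ S = Algebra.trdeg ℝ R := by
  algebraize [g.toRingHom]
  have : Algebra.IsIntegral R S := ⟨hi⟩
  have : FaithfulSMul R S := (faithfulSMul_iff_algebraMap_injective R S).2 hg
  have := trdeg_add_eq ℝ R (A := S)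
  rw [← this, trdeg_eq_zero (R := R) (A := S), add_zero]

lemma dim_ge {B : Type} [CommRing B] [Algebra ℝ B] [Algebra.FiniteType ℝ B] {d : ℕ}
    (f : MvPolynomial (Fin d) ℝ →ₐ[ℝ] B) (hf : Function.Injective f) :
    (d : WithBot ℕ∞) ≤ ringKrullDim B := by
  obtain ⟨P, hP, hP2⟩ := Ideal.exists_comap_eq_of_mem_minimalPrimes_of_injective
    (f := (f : MvPolynomial (Fin d) ℝ →+* B)) hf ⊥ (by 
      rw [IsDomain.minimalPrimes_eq_singleton_bot]; rfl)
  let D := B ⧸ P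
  let π : B →ₐ[ℝ] D := Ideal.Quotient.mkₐ ℝ P
  have hπ : Function.Surjective π := Ideal.Quotient.mkₐ_surjective ℝ P
  have : Algebra.FiniteType ℝ D := Algebra.FiniteType.of_surjective π hπ
  have hinj : Function.Injective (π.comp f) := by
    rw [injective_iff_map_eq_zero]
    intro a ha
    have h1 : f a ∈ P := Ideal.Quotient.eq_zero_iff_mem.1 ha
    have h2 : a ∈ P.comap (f : MvPolynomial (Fin d) ℝ →+* B) := h1
    rw [hP2] at h2
    exact h2
  obtain ⟨s, g, hg, hgi⟩ := exists_integral_inj_algHom_of_fg ℝ D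
  have h1 := trdeg_le_of_injective _ hinj
  rw [trdeg_of_integral g hg hgi, MvPolynomial.trdeg_of_isDomain, MvPolynomial.trdeg_of_isDomain] at h1
  have h2 : d ≤ s := by simpa using h1
  have h3 := dim_le_of_integral (g : MvPolynomial (Fin s) ℝ →+* D) hg hgi
  rw [MvPolynomial.ringKrullDim_of_isNoetherianRing, ringKrullDim_eq_zero_of_field, zero_add,
    Nat.card_eq_fintype_card, Fintype.card_fin] at h3
  have h4 := ringKrullDim_le_of_surjective (π : B →+* D) hπ
  exact le_trans (by exact_mod_cast h2) (h3.trans h4)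

end SAx
namespace SAx
open Filter Topology

lemma hasStrict {n : ℕ} (p : MvPolynomial (Fin n) ℝ) (x : Fin n → ℝ) :
    HasStrictFDerivAt (fun y => eval y p)
      (∑ i, eval x (pderiv i p) • (ContinuousLinearMap.proj i : (Fin n → ℝ) →L[ℝ] ℝ)) x := by
  induction p using MvPolynomial.induction_on with
  | C a =>
    simp only [eval_C, pderiv_C, map_zero, zero_smul, Finset.sum_const_zero]
    exact hasStrictFDerivAt_const a x
  | add p q hp hq =>
    have h := hp.add hq
    have e : (fun y => eval y (p + q)) = (fun y => eval y p) + fun y => eval y q := by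
      ext y; simp
    rw [e]
    refine h.congr_fderiv ?_
    simp [add_smul, Finset.sum_add_distrib]
  | mul_X p i hp =>
    have h := hp.mul
      ((ContinuousLinearMap.proj i : (Fin n → ℝ) →L[ℝ] ℝ).hasStrictFDerivAt (x := x))
    have e : (fun y => eval y (p * X i)) = (fun y => eval y p) *
        ⇑(ContinuousLinearMap.proj i : (Fin n → ℝ) →L[ℝ] ℝ) := by
      ext y; simp
    rw [e]
    refine h.congr_fderiv ?_
    ext v
    have : ∀ j, (eval x) ((pderiv j) (p * X i)) * v j =
        eval x p * (if j = i then v j else 0) + x i * (eval x (pderiv j p) * v j) := by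
      intro j
      rw [pderiv_mul, pderiv_X]
      by_cases hj : j = i
      · subst hj; simp; ring
      · simp [hj, Ne.symm hj]; ring
    have h2 : ∑ j, (eval x) ((pderiv j) (p * X i)) * v j =
        eval x p * v i + x i * ∑ j, eval x (pderiv j p) * v j := by
      rw [Finset.sum_congr rfl fun j _ => this j, Finset.sum_add_distrib, Finset.mul_sum]
      simp
    simpa [-Derivation.leibniz] using h2.symm

lemma exists_compl' {n m : ℕ} (r : Fin m → Fin n → ℝ) (h : LinearIndependent ℝ r) (d : ℕ)
    (hd : m + d = n) : ∃ s : Fin d → Fin n → ℝ, LinearIndependent ℝ (Sum.elim r s) := by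
  obtain ⟨W, hW⟩ := (Submodule.span ℝ (Set.range r)).exists_isCompl
  have h3 := Submodule.finrank_add_eq_of_isCompl hW
  rw [finrank_span_eq_card h] at h3
  simp at h3
  have h4 : Module.finrank ℝ W = d := by omega
  let b := Module.finBasisOfFinrankEq ℝ W h4
  refine ⟨fun k => (b k : Fin n → ℝ), ?_⟩
  refine LinearIndependent.sum_type h ?_ ?_
  · exact b.linearIndependent.map' W.subtype (by simp)
  · refine hW.disjoint.mono_right ?_
    rw [Submodule.span_le]
    rintro _ ⟨k, rfl⟩
    exact (b k).2

lemma surj_of_li {n : ℕ} {ι : Type} [Fintype ι] (r : ι → Fin n → ℝ) (h : LinearIndependent ℝ r) :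
    Function.Surjective (fun (v : Fin n → ℝ) (j : ι) => ∑ i, r j i * v i) := by
  let A : Matrix ι (Fin n) ℝ := Matrix.of r
  have h1 : LinearIndependent ℝ A.row := h
  have h2 : A.rank = Fintype.card ι := h1.rank_matrix
  have h3 : LinearMap.range A.mulVecLin = ⊤ := by
    apply Submodule.eq_top_of_finrank_eq
    rw [← Matrix.rank, h2]; simp
  have h4 := LinearMap.range_eq_top.1 h3
  exact h4

lemma quot_dim_ge {n d : ℕ} (Z : Set (Fin n → ℝ)) (l : Fin d → MvPolynomial (Fin n) ℝ)
    (c : Fin d → ℝ)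
    (h : ∀ᶠ v in 𝓝 c, ∃ z ∈ Z, (fun k => eval z (l k)) = v) :
    (d : WithBot ℕ∞) ≤ ringKrullDim (MvPolynomial (Fin n) ℝ ⧸ vanishingIdealOf Z) := by
  let π : MvPolynomial (Fin n) ℝ →ₐ[ℝ] (MvPolynomial (Fin n) ℝ ⧸ vanishingIdealOf Z) :=
    Ideal.Quotient.mkₐ ℝ _
  have hπ : Function.Surjective π := Ideal.Quotient.mkₐ_surjective ℝ _
  have : Algebra.FiniteType ℝ (MvPolynomial (Fin n) ℝ ⧸ vanishingIdealOf Z) :=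
    Algebra.FiniteType.of_surjective π hπ
  refine dim_ge (π.comp (aeval l)) ?_
  rw [injective_iff_map_eq_zero]
  intro a ha
  have h1 : aeval l a ∈ vanishingIdealOf Z := Ideal.Quotient.eq_zero_iff_mem.1 ha
  obtain ⟨ε, hε, hb⟩ := Metric.eventually_nhds_iff_ball.1 h
  refine MvPolynomial.funext_set (fun k => Metric.ball (c k) ε) (fun k => ?_) ?_
  · rw [Real.ball_eq_Ioo]; exact Set.Ioo_infinite (by linarith)
  · intro v hv
    have hv' : v ∈ Metric.ball c ε := by
      rw [ball_pi _ hε]; exact hv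
    obtain ⟨z, hz, rfl⟩ := hb v hv'
    have h2 := h1 z hz
    rw [map_zero, ← h2]
    rw [← MvPolynomial.aeval_eq_eval, ← MvPolynomial.aeval_eq_eval,
      ← AlgHom.comp_apply, MvPolynomial.comp_aeval]

lemma regular_param {n d : ℕ} (hd : d ≤ n) (x : Fin n → ℝ)
    (p : Fin (n - d) → MvPolynomial (Fin n) ℝ) (hx : ∀ j, eval x (p j) = 0)
    (hli : LinearIndependent ℝ fun j : Fin (n - d) =>
        fun i : Fin n => MvPolynomial.eval x (MvPolynomial.pderiv i (p j)))
    (W : Set (Fin n → ℝ)) (hW : W ∈ 𝓝 x) :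
    ∃ (l : Fin d → MvPolynomial (Fin n) ℝ) (c : Fin d → ℝ),
      ∀ᶠ v in 𝓝 c, ∃ z ∈ W, (∀ j, eval z (p j) = 0) ∧ (fun k => eval z (l k)) = v := by
  obtain ⟨s, hs⟩ := exists_compl' _ hli d (by omega)
  let l : Fin d → MvPolynomial (Fin n) ℝ := fun k => ∑ i, C (s k i) * X i
  let q : Fin (n - d) ⊕ Fin d → MvPolynomial (Fin n) ℝ := Sum.elim p l
  let F : (Fin n → ℝ) → (Fin (n - d) ⊕ Fin d → ℝ) := fun y j => eval y (q j)
  let F' : (Fin n → ℝ) →L[ℝ] (Fin (n - d) ⊕ Fin d → ℝ) := ContinuousLinearMap.pi fun j =>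
    (∑ i, eval x (pderiv i (q j)) • (ContinuousLinearMap.proj i : (Fin n → ℝ) →L[ℝ] ℝ))
  have hF : HasStrictFDerivAt F F' x := hasStrictFDerivAt_pi.2 fun j => hasStrict (q j) x
  have hr : F'.range = ⊤ := by
    rw [LinearMap.range_eq_top]
    convert surj_of_li _ hs using 1
    ext v j
    rcases j with j | k
    · simp [F', q]
    · simp [F', q, l, pderiv_X, Pi.single_apply]
  have hmap := hF.map_nhds_eq_of_surj hr
  refine ⟨l, fun k => eval x (l k), ?_⟩
  have himg : F '' W ∈ 𝓝 (F x) := by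
    rw [← hmap]; exact image_mem_map hW
  let G : (Fin d → ℝ) → (Fin (n - d) ⊕ Fin d → ℝ) := fun v => Sum.elim (fun _ => 0) v
  have hG : Continuous G := by
    refine continuous_pi fun j => ?_
    rcases j with j | k
    · exact continuous_const
    · exact continuous_apply k
  have hGx : G (fun k => eval x (l k)) = F x := by
    ext j
    rcases j with j | k
    · simp [G, F, q, hx]
    · simp [G, F, q]
  have := (hG.tendsto (fun k => eval x (l k))).eventually_mem (hGx ▸ himg)
  filter_upwards [this] with v hv
  obtain ⟨z, hz, hzv⟩ := hv
  refine ⟨z, hz, fun j => ?_, ?_⟩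
  · exact congrFun hzv (Sum.inl j)
  · ext k; exact congrFun hzv (Sum.inr k)

lemma dim_lt {n : ℕ} (Y U : Set (Fin n → ℝ)) (hX : IsRealAlgebraicSet Y)
    (hU : IsZariskiOpenIn Y U) (hD : IsZariskiDenseIn Y U) :
    ringKrullDim (MvPolynomial (Fin n) ℝ ⧸ vanishingIdealOf (Y \ U)) + 1 ≤ algDim Y := by
  obtain ⟨hUX, k, p, hp⟩ := hU
  let h : MvPolynomial (Fin n) ℝ := ∑ i, p i ^ 2
  have hh : ∀ y, eval y h = 0 ↔ y ∈ Y \ U := by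
    intro y
    rw [hp]
    simp only [h, map_sum, map_pow, mem_ofPred_eq]
    rw [Finset.sum_eq_zero_iff_of_nonneg (fun i _ => sq_nonneg _)]
    simp
  have hle : vanishingIdealOf Y ≤ vanishingIdealOf (Y \ U) := fun g hg y hy => hg y hy.1
  refine ringKrullDim_succ_le_of_surjective (Ideal.Quotient.factor hle)
    (Ideal.Quotient.factor_surjective hle) (r := Ideal.Quotient.mk _ h) ?_ ?_
  · rw [mem_nonZeroDivisors_iff_right]
    intro g hg
    obtain ⟨g, rfl⟩ := Ideal.Quotient.mk_surjective g
    rw [← map_mul, Ideal.Quotient.eq_zero_iff_mem] at hg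
    rw [Ideal.Quotient.eq_zero_iff_mem]
    have hgU : ∀ y ∈ U, eval y g = 0 := by
      intro y hy
      have h1 : eval y (g * h) = 0 := hg y (hUX hy)
      rw [map_mul, mul_eq_zero] at h1
      rcases h1 with h1 | h1
      · exact h1
      · exact absurd hy ((hh y).1 h1).2
    obtain ⟨m, q, rfl⟩ := hX
    have := hD ({x | ∀ i, eval x (q i) = 0} ∩ {x | eval x g = 0})
      ⟨⟨m + 1, Fin.cons g q, by
        ext y; simp [Fin.forall_fin_succ, and_comm]⟩, inter_subset_left⟩
      (fun y hy => ⟨hUX hy, hgU y hy⟩)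
    intro y hy
    rw [← this] at hy
    exact hy.2
  · rw [Ideal.Quotient.factor_mk, Ideal.Quotient.eq_zero_iff_mem]
    intro y hy
    exact (hh y).2 hy

lemma dense {n : ℕ} (Y U : Set (Fin n → ℝ)) (hX : IsRealAlgebraicSet Y) (hc : IsCentral Y)
    (hU : IsZariskiOpenIn Y U) (hD : IsZariskiDenseIn Y U) : Y ⊆ closure U := by
  rw [← hc]
  refine closure_minimal ?_ isClosed_closure
  rintro x ⟨hxY, d, hd, p, V, hVo, hxV, hVe, hli⟩
  by_contra hx
  have hW : V ∩ (closure U)ᶜ ∈ 𝓝 x :=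
    (hVo.inter isClosed_closure.isOpen_compl).mem_nhds ⟨hxV, hx⟩
  have hdn : d ≤ n := by
    have h1 : algDim Y ≤ ringKrullDim (MvPolynomial (Fin n) ℝ) :=
      ringKrullDim_le_of_surjective _ Ideal.Quotient.mk_surjective
    rw [MvPolynomial.ringKrullDim_of_isNoetherianRing, ringKrullDim_eq_zero_of_field, zero_add,
      Nat.card_eq_fintype_card, Fintype.card_fin, hd] at h1
    exact_mod_cast h1
  have hx0 : ∀ j, eval x (p j) = 0 := by
    have : x ∈ Y ∩ V := ⟨hxY, hxV⟩
    rw [hVe] at this; exact this.2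
  obtain ⟨l, c, hlc⟩ := regular_param hdn x p hx0 hli _ hW
  have h1 := quot_dim_ge (Y \ U) l c (by
    filter_upwards [hlc] with v hv
    obtain ⟨z, hz, hz0, hzv⟩ := hv
    have : z ∈ Y ∩ V := by rw [hVe]; exact ⟨hz.1, hz0⟩
    exact ⟨z, ⟨this.1, fun h => hz.2 (subset_closure h)⟩, hzv⟩)
  have h2 := dim_lt Y U hX hU hD
  rw [hd] at h2
  have h3 : (d : WithBot ℕ∞) + 1 ≤ d := le_trans (by gcongr) h2
  have h4 : ((d + 1 : ℕ) : WithBot ℕ∞) ≤ (d : ℕ) := by exact_mod_cast h3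
  have h5 : d + 1 ≤ d := by exact_mod_cast h4
  omega

end SAx
namespace SAx
open Filter Topology

open Classical in
lemma Q.isSemialgebraic {m : ℕ} {S : Set (Fin m → ℝ)} (h : Q S) : IsSemialgebraic S := by
  obtain ⟨G, hG⟩ := h
  let T := {s : G → SignType // ∃ x ∈ S, ∀ g : G, SignType.sign (eval x g.1) = s g}
  let e : T ≃ Fin (Fintype.card T) := Fintype.equivFin T
  let e' : G ≃ Fin (Fintype.card G) := Fintype.equivFin G
  refine ⟨Fintype.card T, fun i => ∑ g : G, if (e.symm i).1 g = 0 then g.1 ^ 2 else 0,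
    fun _ => Fintype.card G, fun i j => if (e.symm i).1 (e'.symm j) = 1 then (e'.symm j).1 else
      if (e.symm i).1 (e'.symm j) = -1 then -(e'.symm j).1 else 1, ?_⟩
  have key : ∀ (t : T) (x : Fin m → ℝ),
      (eval x (∑ g : G, if t.1 g = 0 then g.1 ^ 2 else 0) = 0 ∧
        ∀ j, 0 < eval x (if t.1 (e'.symm j) = 1 then (e'.symm j).1 else
          if t.1 (e'.symm j) = -1 then -(e'.symm j).1 else 1)) ↔
      ∀ g : G, SignType.sign (eval x g.1) = t.1 g := by
    intro t x
    have h1 : eval x (∑ g : G, if t.1 g = 0 then g.1 ^ 2 else 0) = 0 ↔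
        ∀ g : G, t.1 g = 0 → eval x g.1 = 0 := by
      rw [map_sum, Finset.sum_eq_zero_iff_of_nonneg]
      · refine forall_congr' fun g => ?_
        by_cases h : t.1 g = 0 <;> simp [h]
      · intro g _
        by_cases h : t.1 g = 0
        · simp only [h, if_true, map_pow]; exact sq_nonneg _
        · simp [h]
    rw [h1, e'.symm.forall_congr_left (p := fun j => 0 < eval x (if t.1 (e'.symm j) = 1 then (e'.symm j).1 else
          if t.1 (e'.symm j) = -1 then -(e'.symm j).1 else 1)), ← forall_and]
    refine forall_congr' fun g => ?_
    simp only [Equiv.symm_symm, Equiv.symm_apply_apply]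
    rcases hs : t.1 g with _ | _ | _
    · simp
    · have : (SignType.neg : SignType) = -1 := rfl
      rw [this, sign_eq_neg_one_iff]; simp
    · have : (SignType.pos : SignType) = 1 := rfl
      rw [this, sign_eq_one_iff]; simp
  ext x
  rw [mem_iUnion]
  constructor
  · intro hx
    let t : T := ⟨fun g => SignType.sign (eval x g.1), x, hx, fun _ => rfl⟩
    refine ⟨e t, ?_⟩
    have := (key t x).2 fun _ => rfl
    simpa using this
  · rintro ⟨i, hi⟩
    have h1 := (key (e.symm i) x).1 hi
    obtain ⟨y, hy, h2⟩ := (e.symm i).2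
    exact hG y x (fun g hg => (h2 ⟨g, hg⟩).trans (h1 ⟨g, hg⟩).symm) hy

lemma Q.alg {n : ℕ} {Y : Set (Fin n → ℝ)} (h : IsRealAlgebraicSet Y) : Q Y := by
  obtain ⟨k, p, rfl⟩ := h
  have := Q.iInter (fun i => Q.zero (p i))
  convert this using 1
  ext x; simp

lemma graph_Q {n : ℕ} (Y U : Set (Fin n → ℝ)) (hX : IsRealAlgebraicSet Y)
    (hU : IsZariskiOpenIn Y U) (f : (Fin n → ℝ) → ℝ) (hf : IsRegularOnSet U f) :
    Q (graphOn U f) := by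
  obtain ⟨p, q, hq, hpq⟩ := hf
  have h1 : Q {y : Fin (n + 1) → ℝ | (fun i : Fin n => y i.castSucc) ∈ Y ∩ (Y \ U)ᶜ} := by
    have := ((Q.alg hX).inter (Q.alg hU.2).compl).preimage
      (fun i : Fin n => (X i.castSucc : MvPolynomial (Fin (n + 1)) ℝ))
    simpa using this
  have h2 := h1.inter (Q.zero (rename Fin.castSucc q * X (Fin.last n) - rename Fin.castSucc p))
  convert h2 using 1
  ext y
  have hYU : Y ∩ (Y \ U)ᶜ = U := by
    ext z
    simp only [mem_inter_iff, mem_compl_iff, Set.mem_sdiff, not_and, not_not]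
    exact ⟨fun h => h.2 h.1, fun h => ⟨hU.1 h, fun _ => h⟩⟩
  rw [hYU]
  have : ∀ r : MvPolynomial (Fin n) ℝ, eval y (rename Fin.castSucc r) =
      eval (fun i : Fin n => y i.castSucc) r := fun r => by rw [eval_rename]; rfl
  show (_ ∧ _) ↔ (_ ∧ _)
  refine and_congr_right fun hy => ?_
  show _ ↔ eval y _ = 0
  rw [map_sub, map_mul, this, this, eval_X, hpq _ hy, eq_div_iff (hq _ hy), sub_eq_zero, mul_comm]

lemma graph_closure {n : ℕ} (Y U : Set (Fin n → ℝ)) (hY : IsClosed Y) (hUY : U ⊆ Y)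
    (hd : Y ⊆ closure U) (f : (Fin n → ℝ) → ℝ) (hf : ContinuousOn f Y) :
    graphOn Y f = closure (graphOn U f) := by
  let R : (Fin (n + 1) → ℝ) → (Fin n → ℝ) := fun y i => y i.castSucc
  have hR : Continuous R := continuous_pi fun i => continuous_apply _
  apply Subset.antisymm
  · rintro y ⟨hy, hy2⟩
    have hcl : R y ∈ closure U := hd hy
    let g : (Fin n → ℝ) → (Fin (n + 1) → ℝ) := fun z => Fin.snoc z (f z)
    have hg : ContinuousWithinAt g U (R y) := by
      rw [continuousWithinAt_pi]
      intro i
      refine Fin.lastCases ?_ (fun i => ?_) i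
      · simpa [g] using (hf _ hy).mono hUY
      · simpa [g] using (continuous_apply i).continuousWithinAt
    have h1 : g (R y) ∈ closure (g '' U) := hg.mem_closure_image hcl
    have h2 : g (R y) = y := by
      ext i
      refine Fin.lastCases ?_ (fun i => ?_) i
      · simp [g, hy2, R]
      · simp [g, R]
    rw [h2] at h1
    refine closure_mono ?_ h1
    rintro _ ⟨z, hz, rfl⟩
    simpa [_root_.graphOn, g] using hz
  · refine closure_minimal ?_ ?_
    · rintro y ⟨hy, hy2⟩; exact ⟨hUY hy, hy2⟩
    · have hc : IsClosed (R ⁻¹' Y) := hY.preimage hR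
      have h1 : ContinuousOn (fun y => y (Fin.last n) - f (R y)) (R ⁻¹' Y) :=
        (continuous_apply _).continuousOn.sub (hf.comp hR.continuousOn fun _ h => h)
      have h2 := h1.preimage_isClosed_of_isClosed hc (isClosed_singleton (x := (0 : ℝ)))
      convert h2 using 1
      ext y
      simp [_root_.graphOn, R, sub_eq_zero]

end SAx

/-- on a central real algebraic set, every rational continuous function is
semi-algebraic. -/
theorem ratCont_isSemialgebraicFn_of_central {n : ℕ} (X : Set (Fin n → ℝ))
    (hX : IsRealAlgebraicSet X) (hc : IsCentral X)
    (f : (Fin n → ℝ) → ℝ) (hf : IsRatCont X f) :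
    IsSemialgebraicFnOn X f := by
  obtain ⟨hcont, U, hU, hD, hreg⟩ := hf
  have hcl : IsClosed X := by rw [← hc]; exact isClosed_closure
  show IsSemialgebraic (graphOn X f)
  rw [SAx.graph_closure X U hcl hU.1 (SAx.dense X U hX hc hU hD) f hcont]
  exact (SAx.graph_Q X U hX hU f hreg).closure.isSemialgebraic
end

section
/- Let X ⊆ ℝⁿ be a real algebraic set and let f be a rational continuous function on X. Let W = pol(f) be the polar locus of f in X. If the restriction f|_W is a regulous function on W (i.e. f|_W is the restriction to W of a regulous function on ℝⁿ), then f is a regulous function on X (i.e. f is the restriction to X of a regulous function on ℝⁿ). -/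
open MvPolynomial Set

/-- The "infinitesimals" relative to a convex subring. -/
def InfOf {H : Type*} [Field H] [LinearOrder H] (O : Subring H) (z : H) : Prop :=
  ∀ u ∈ O, |z * u| < 1

section Hens

variable {H : Type*} [Field H] [LinearOrder H] [IsStrictOrderedRing H] {O : Subring H}

theorem InfOf.mul {z u : H} (hz : InfOf O z) (hu : u ∈ O) : InfOf O (z * u) := by
  intro v hv
  rw [mul_assoc]
  exact hz _ (O.mul_mem hu hv)

theorem InfOf.of_le {z y : H} (hz : InfOf O z) (h : |y| ≤ |z|) : InfOf O y := by
  intro v hv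
  refine lt_of_le_of_lt ?_ (hz v hv)
  rw [abs_mul, abs_mul]
  exact mul_le_mul_of_nonneg_right h (abs_nonneg _)

theorem InfOf.add {z y : H} (hz : InfOf O z) (hy : InfOf O y) : InfOf O (z + y) := by
  intro v hv
  have h2 : (2 : H) * v ∈ O := by rw [two_mul]; exact O.add_mem hv hv
  have h1 := hz _ h2
  have h3 := hy _ h2
  have e : (z + y) * v = (z * (2 * v) + y * (2 * v)) / 2 := by ring
  rw [e, abs_lt]
  rw [abs_lt] at h1 h3
  constructor <;> linarith

theorem InfOf.neg {z : H} (hz : InfOf O z) : InfOf O (-z) := hz.of_le (by simp)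

theorem InfOf.sub {z y : H} (hz : InfOf O z) (hy : InfOf O y) : InfOf O (z - y) := by
  rw [sub_eq_add_neg]; exact hz.add hy.neg

theorem InfOf.zero : InfOf O (0 : H) := by intro u _; simp

theorem InfOf.mem (hO : ∀ a b : H, |a| ≤ |b| → b ∈ O → a ∈ O) {z : H} (hz : InfOf O z) : z ∈ O := by
  have := hz 1 O.one_mem
  exact hO z 1 (by rw [abs_one]; simpa using this.le) O.one_mem

theorem inv_mem_of_not_inf (hO : ∀ a b : H, |a| ≤ |b| → b ∈ O → a ∈ O) {z : H}
    (hz : ¬ InfOf O z) : z⁻¹ ∈ O := by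
  unfold InfOf at hz
  push Not at hz
  obtain ⟨u, hu, h⟩ := hz
  have hz0 : z ≠ 0 := by
    rintro rfl
    simp at h
    linarith [zero_lt_one (α := H)]
  refine hO _ u ?_ hu
  rw [abs_mul] at h
  rw [abs_inv, inv_le_iff_one_le_mul₀ (abs_pos.mpr hz0), mul_comm]
  exact h

theorem hensel_convex
    (ivt : ∀ (P : Polynomial H) (a b : H), a ≤ b → P.eval a ≤ 0 → 0 ≤ P.eval b →
      ∃ c, a ≤ c ∧ c ≤ b ∧ P.eval c = 0)
    (hO : ∀ a b : H, |a| ≤ |b| → b ∈ O → a ∈ O)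
    (P : Polynomial O) (z : O) (h1 : InfOf O (P.eval z : O).1)
    (h2 : ¬ InfOf O (P.derivative.eval z : O).1) :
    ∃ z' : H, InfOf O (z - z') ∧ (P.map O.subtype).eval z' = 0 := by
  set c : H := (P.eval z : O).1 with hc
  set e : H := (P.derivative.eval z : O).1 with he
  have hei := inv_mem_of_not_inf hO h2
  have he0 : e ≠ 0 := by
    intro h; apply h2; rw [h]; exact InfOf.zero
  set d : H := 2 * (c / e) with hd
  have hdi : InfOf O d := by
    have : d = c * (2 * e⁻¹) := by rw [hd]; ring
    rw [this]
    refine h1.mul ?_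
    rw [two_mul]; exact O.add_mem hei hei
  have key : ∀ t : O, (t : H) ^ 2 = d ^ 2 → |((P.eval (z + t) : O) : H) - e * t| ≤ 2 * |c| := by
    intro t ht
    obtain ⟨k, hk⟩ := Polynomial.binomExpansion P z t
    rw [hk]
    push_cast
    rw [← hc, ← he, ht]
    have h4 : (k : H) * (4 * (e⁻¹ * e⁻¹)) ∈ O := by
      refine O.mul_mem k.2 (O.mul_mem ?_ (O.mul_mem hei hei))
      exact_mod_cast natCast_mem O 4
    have h5 := h1 _ h4
    have e1 : c + e * t + k * d ^ 2 - e * t = c + c * (c * (k * (4 * (e⁻¹ * e⁻¹)))) := by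
      rw [hd]; field_simp; ring
    rw [e1]
    calc _ ≤ |c| + |c * (c * (k * (4 * (e⁻¹ * e⁻¹))))| := abs_add_le _ _
      _ ≤ |c| + |c| * 1 := by
        rw [abs_mul c (c * _)]
        gcongr
      _ = _ := by ring
  have hev : ∀ t : O, (P.map O.subtype).eval ((z : H) + t) = ((P.eval (z + t) : O) : H) := by
    intro t
    have : ((z : H) + t) = O.subtype (z + t) := by simp
    rw [this, Polynomial.eval_map, Polynomial.eval₂_at_apply]
    rfl
  have hdO : d ∈ O := hdi.mem hO
  have hadO : |d| ∈ O := hO _ d (by simp) hdO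
  have ed : abs (e * |d|) = 2 * |c| := by
    rw [hd, abs_mul, abs_abs, abs_mul, abs_div, abs_two]
    have : |e| ≠ 0 := abs_ne_zero.mpr he0
    field_simp
  have k1 := key ⟨|d|, hadO⟩ (by simp)
  have k2 := key (-⟨|d|, hadO⟩) (by simp)
  rw [← hev, abs_le] at k1 k2
  simp only [NegMemClass.coe_neg] at k1 k2
  have hle : (z : H) + -|d| ≤ z + |d| := by linarith [abs_nonneg d]
  have fin : ∃ c, (z : H) + -|d| ≤ c ∧ c ≤ z + |d| ∧ (P.map O.subtype).eval c = 0 := by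
    rcases le_total 0 e with hpos | hneg
    · rw [abs_of_nonneg (mul_nonneg hpos (abs_nonneg _))] at ed
      apply ivt _ _ _ hle <;> linarith
    · rw [abs_of_nonpos (mul_nonpos_of_nonpos_of_nonneg hneg (abs_nonneg _))] at ed
      have := ivt (-(P.map O.subtype)) _ _ hle (by rw [Polynomial.eval_neg]; linarith)
        (by rw [Polynomial.eval_neg]; linarith)
      simpa using this
  obtain ⟨z', q1, q2, q3⟩ := fin
  refine ⟨z', hdi.of_le ?_, q3⟩
  rw [abs_le]; constructor <;> linarith

theorem exists_coefficient_field
    (ivt : ∀ (P : Polynomial H) (a b : H), a ≤ b → P.eval a ≤ 0 → 0 ≤ P.eval b →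
      ∃ c, a ≤ c ∧ c ≤ b ∧ P.eval c = 0)
    (hO : ∀ a b : H, |a| ≤ |b| → b ∈ O → a ∈ O)
    (F0 : Subfield H) (hF0 : ∀ x ∈ F0, x ∈ O) :
    ∃ K : Subfield H, F0 ≤ K ∧ (∀ x ∈ K, x ∈ O) ∧ ∀ z ∈ O, ∃ z' ∈ K, InfOf O (z - z') := by
  obtain ⟨K, hFK, hKmax⟩ := zorn_le_nonempty₀ {K : Subfield H | ∀ x ∈ K, x ∈ O} (by
    intro c hc hch y hy
    refine ⟨sSup c, ?_, fun z hz => le_sSup hz⟩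
    intro x hx
    rw [Subfield.mem_sSup_of_directedOn ⟨y, hy⟩ hch.directedOn] at hx
    obtain ⟨s, hs, hxs⟩ := hx
    exact hc hs x hxs) F0 hF0
  have hKO : ∀ x ∈ K, x ∈ O := hKmax.1
  refine ⟨K, hFK, hKO, ?_⟩
  intro z hz
  -- maximality in a usable form
  have hmax : ∀ y : H, (∀ x ∈ IntermediateField.adjoin K {y}, x ∈ O) → y ∈ K := by
    intro y hy
    have h1 : K ≤ (IntermediateField.adjoin K {y}).toSubfield := by
      intro x hx
      exact (IntermediateField.adjoin K {y}).algebraMap_mem ⟨x, hx⟩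
    have h2 := hKmax.2 (y := (IntermediateField.adjoin K {y}).toSubfield) hy h1
    exact h2 (IntermediateField.mem_adjoin_simple_self K y)
  let i : K →+* O := K.subtype.codRestrict O (fun x => hKO x.1 x.2)
  have hcomp : O.subtype.comp i = algebraMap K H := rfl
  have haev : ∀ (P : Polynomial K) (y : H) (hy : y ∈ O),
      Polynomial.aeval y P = (((P.map i).eval (⟨y, hy⟩ : O) : O) : H) := by
    intro P y hy
    rw [Polynomial.aeval_def, ← hcomp]
    rw [Polynomial.eval_map]
    change _ = O.subtype _
    rw [Polynomial.hom_eval₂]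
    rfl
  by_cases hT : ∃ P : Polynomial K, P ≠ 0 ∧ InfOf O (Polynomial.aeval z P)
  · -- algebraic case
    classical
    let S : Set ℕ := {d | ∃ P : Polynomial K, P ≠ 0 ∧ InfOf O (Polynomial.aeval z P) ∧ P.natDegree = d}
    have hS : ∃ d, d ∈ S := by
      obtain ⟨P, h1, h2⟩ := hT
      exact ⟨_, P, h1, h2, rfl⟩
    obtain ⟨P, hP0, hPi, hPd⟩ := Nat.find_spec hS
    have hmin : ∀ Q : Polynomial K, Q ≠ 0 → Q.natDegree < P.natDegree →
        ¬ InfOf O (Polynomial.aeval z Q) := by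
      intro Q hQ hlt hQi
      rw [hPd] at hlt
      exact Nat.find_min hS hlt ⟨Q, hQ, hQi, rfl⟩
    have hdeg : P.natDegree ≠ 0 := by
      intro h0
      rw [Polynomial.eq_C_of_natDegree_eq_zero h0] at hPi hP0
      rw [Polynomial.aeval_C] at hPi
      have hne : P.coeff 0 ≠ 0 := by
        intro h; apply hP0; rw [h]; simp
      have hne' : ((P.coeff 0 : K) : H) ≠ 0 := by
        intro h; exact hne (Subtype.ext h)
      have := hPi _ (hKO _ (K.inv_mem (P.coeff 0).2))
      change |((P.coeff 0 : K) : H) * ((P.coeff 0 : K) : H)⁻¹| < 1 at this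
      rw [mul_inv_cancel₀ hne'] at this
      simp at this
    have hder : ¬ InfOf O (Polynomial.aeval z P.derivative) := by
      apply hmin
      · intro h
        exact hdeg (Polynomial.derivative_eq_zero.mp h)
      · exact Polynomial.natDegree_derivative_lt hdeg
    rw [haev _ _ hz] at hPi hder
    rw [← Polynomial.derivative_map] at hder
    obtain ⟨z', hzz', hroot⟩ := hensel_convex ivt hO (P.map i) ⟨z, hz⟩ hPi hder
    have hz'O : z' ∈ O := by
      have := O.sub_mem hz (hzz'.mem hO)
      simpa using this
    refine ⟨z', hmax z' ?_, hzz'⟩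
    have halg : IsAlgebraic K z' := by
      refine ⟨P, hP0, ?_⟩
      rw [Polynomial.map_map, hcomp, Polynomial.eval_map] at hroot
      exact hroot
    intro x hx
    rw [← IntermediateField.mem_toSubalgebra,
      IntermediateField.adjoin_simple_toSubalgebra_of_isAlgebraic halg,
      Algebra.adjoin_singleton_eq_range_aeval] at hx
    obtain ⟨Q, rfl⟩ := hx
    change Polynomial.aeval z' Q ∈ O
    rw [haev _ _ hz'O]
    exact Subtype.property _
  · push Not at hT
    refine ⟨z, hmax z ?_, by rw [sub_self]; exact InfOf.zero⟩
    intro x hx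
    rw [IntermediateField.mem_adjoin_simple_iff] at hx
    obtain ⟨r, s, rfl⟩ := hx
    by_cases hs : s = 0
    · rw [hs]; simp
    rw [div_eq_mul_inv]
    refine O.mul_mem ?_ (inv_mem_of_not_inf hO (hT s hs))
    rw [haev _ _ hz]
    exact Subtype.property _

end Hens

theorem hyper_ivt (P : Polynomial Hyperreal) (a b : Hyperreal) (hab : a ≤ b)
    (ha : P.eval a ≤ 0) (hb : 0 ≤ P.eval b) : ∃ c, a ≤ c ∧ c ≤ b ∧ P.eval c = 0 := by
  let φ : (ℕ → ℝ) →+* Hyperreal := Filter.Germ.coeRingHom (Filter.hyperfilter ℕ : Filter ℕ)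
  have hsurj : Function.Surjective φ := fun x => Quotient.inductionOn' x fun f => ⟨f, rfl⟩
  obtain ⟨Q, rfl⟩ := Polynomial.map_surjective φ hsurj P
  obtain ⟨a, rfl⟩ := hsurj a
  obtain ⟨b, rfl⟩ := hsurj b
  have hle : ∀ u v : ℕ → ℝ, φ u ≤ φ v ↔ ∀ᶠ k in (Filter.hyperfilter ℕ : Filter ℕ), u k ≤ v k :=
    fun u v => Iff.rfl
  have heq : ∀ u v : ℕ → ℝ, φ u = φ v ↔ ∀ᶠ k in (Filter.hyperfilter ℕ : Filter ℕ), u k = v k :=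
    fun u v => Filter.Germ.coe_eq
  have hev : ∀ (u : ℕ → ℝ) (k : ℕ), (Q.eval u) k = (Q.map (Pi.evalRingHom (fun _ => ℝ) k)).eval (u k) := by
    intro u k
    have := (Polynomial.eval₂_at_apply (p := Q) (Pi.evalRingHom (fun _ : ℕ => ℝ) k) u).symm
    rw [← Polynomial.eval_map] at this
    exact this
  rw [Polynomial.eval_map, Polynomial.eval₂_at_apply] at ha hb
  rw [← map_zero φ, hle] at ha hb
  rw [hle] at hab
  have : ∀ k, ∃ c : ℝ, a k ≤ b k → (Q.eval a) k ≤ 0 → 0 ≤ (Q.eval b) k →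
      a k ≤ c ∧ c ≤ b k ∧ (Q.map (Pi.evalRingHom (fun _ => ℝ) k)).eval c = 0 := by
    intro k
    by_cases h : a k ≤ b k ∧ (Q.eval a) k ≤ 0 ∧ 0 ≤ (Q.eval b) k
    · obtain ⟨h1, h2, h3⟩ := h
      rw [hev] at h2 h3
      obtain ⟨c, hc, hc0⟩ := intermediate_value_Icc h1
        (Polynomial.continuous (Q.map (Pi.evalRingHom (fun _ => ℝ) k))).continuousOn ⟨h2, h3⟩
      exact ⟨c, fun _ _ _ => ⟨hc.1, hc.2, hc0⟩⟩
    · exact ⟨0, fun h1 h2 h3 => absurd ⟨h1, h2, h3⟩ h⟩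
  choose c hc using this
  refine ⟨φ c, ?_, ?_, ?_⟩
  · rw [hle]; filter_upwards [hab, ha, hb] with k h1 h2 h3 using (hc k h1 h2 h3).1
  · rw [hle]; filter_upwards [hab, ha, hb] with k h1 h2 h3 using (hc k h1 h2 h3).2.1
  · rw [Polynomial.eval_map, Polynomial.eval₂_at_apply, ← map_zero φ, heq]
    filter_upwards [hab, ha, hb] with k h1 h2 h3
    rw [hev]; exact (hc k h1 h2 h3).2.2

/-- A Łojasiewicz inequality. -/
theorem lojasiewicz {n : ℕ} (s : MvPolynomial (Fin n) ℝ) (k : ℕ) :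
    ∃ M : ℕ, ∀ (y : Fin n → ℝ) (D : ℝ), 2 ≤ D → (∀ i, |y i| ≤ D) →
      |MvPolynomial.eval y s| * D ^ M ≤ 1 →
      ∃ x : Fin n → ℝ, MvPolynomial.eval x s = 0 ∧ ∀ i, |y i - x i| * D ^ k ≤ 1 := by
  by_contra hcon
  push Not at hcon
  choose y D hD hyD hs hbad using hcon
  let φ : (ℕ → ℝ) →+* Hyperreal := Filter.Germ.coeRingHom (Filter.hyperfilter ℕ : Filter ℕ)
  have hsurj : Function.Surjective φ := fun x => Quotient.inductionOn' x fun f => ⟨f, rfl⟩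
  have hle : ∀ u v : ℕ → ℝ, φ u ≤ φ v ↔ ∀ᶠ k in (Filter.hyperfilter ℕ : Filter ℕ), u k ≤ v k :=
    fun u v => Iff.rfl
  have hlt : ∀ u v : ℕ → ℝ, φ u < φ v ↔ ∀ᶠ k in (Filter.hyperfilter ℕ : Filter ℕ), u k < v k :=
    fun u v => Filter.Germ.coe_lt
  have heq : ∀ u v : ℕ → ℝ, φ u = φ v ↔ ∀ᶠ k in (Filter.hyperfilter ℕ : Filter ℕ), u k = v k :=
    fun u v => Filter.Germ.coe_eq
  have habs : ∀ u : ℕ → ℝ, |φ u| = φ (fun k => |u k|) := fun u => Filter.Germ.abs_def _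
  have hD2 : (2 : Hyperreal) ≤ φ D := by
    have : (2 : Hyperreal) = φ 2 := (map_ofNat φ 2).symm
    rw [this, hle]; exact Filter.Eventually.of_forall hD
  have hD1 : (1 : Hyperreal) ≤ φ D := le_trans one_le_two hD2
  let O : Subring Hyperreal :=
    { carrier := {z | ∃ j : ℕ, |z| ≤ φ D ^ j}
      zero_mem' := ⟨0, by simp⟩
      one_mem' := ⟨0, by simp⟩
      neg_mem' := by rintro x ⟨j, hj⟩; exact ⟨j, by rwa [abs_neg]⟩
      mul_mem' := by
        rintro x y ⟨j, hj⟩ ⟨l, hl⟩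
        refine ⟨j + l, ?_⟩
        rw [abs_mul, pow_add]
        exact mul_le_mul hj hl (abs_nonneg _) (le_trans (abs_nonneg _) hj)
      add_mem' := by
        rintro x y ⟨j, hj⟩ ⟨l, hl⟩
        refine ⟨max j l + 1, ?_⟩
        have h1 := hj.trans (pow_le_pow_right₀ hD1 (le_max_left j l))
        have h2 := hl.trans (pow_le_pow_right₀ hD1 (le_max_right j l))
        have h3 : (0 : Hyperreal) ≤ φ D ^ (max j l) := (abs_nonneg _).trans h1
        have h4 := abs_add_le x y
        rw [pow_succ]
        nlinarith }
  have hmem : ∀ z, z ∈ O ↔ ∃ j : ℕ, |z| ≤ φ D ^ j := fun z => Iff.rfl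
  have hO : ∀ a b : Hyperreal, |a| ≤ |b| → b ∈ O → a ∈ O := by
    rintro a b hab ⟨j, hj⟩
    exact ⟨j, hab.trans hj⟩
  let cst : ℝ →+* Hyperreal := φ.comp (Pi.constRingHom ℕ ℝ)
  have hF0 : ∀ x ∈ cst.fieldRange, x ∈ O := by
    rintro x ⟨r, rfl⟩
    obtain ⟨j, hj⟩ := pow_unbounded_of_one_lt |r| (one_lt_two)
    refine ⟨j, ?_⟩
    change |φ (fun _ => r)| ≤ _
    rw [habs, ← map_pow, hle]
    refine Filter.Eventually.of_forall fun m => hj.le.trans ?_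
    exact pow_le_pow_left₀ (by norm_num) (hD m) j
  obtain ⟨K, hFK, hKO, hK⟩ := exists_coefficient_field hyper_ivt hO cst.fieldRange hF0
  have hyO : ∀ i, φ (fun m => y m i) ∈ O := by
    intro i
    refine ⟨1, ?_⟩
    rw [habs, pow_one, hle]
    exact Filter.Eventually.of_forall fun m => hyD m i
  choose x' hx'K hx' using fun i => hK _ (hyO i)
  have hev : ∀ (u : Fin n → ℕ → ℝ), MvPolynomial.eval₂ cst (fun i => φ (u i)) s =
      φ (fun m => MvPolynomial.eval (fun i => u i m) s) := by
    intro u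
    have h1 := MvPolynomial.eval₂_comp_left φ (Pi.constRingHom ℕ ℝ) u s
    refine h1.symm.trans ?_
    congr 1
    funext m
    have h2 := MvPolynomial.eval₂_comp_left (Pi.evalRingHom (fun _ : ℕ => ℝ) m)
      (Pi.constRingHom ℕ ℝ) u s
    exact h2
  -- `s(y)` is infinitesimal
  have hsy : InfOf O (MvPolynomial.eval₂ cst (fun i => φ (fun m => y m i)) s) := by
    rw [hev]
    rintro v ⟨j, hj⟩
    rw [abs_mul, habs]
    have hlt1 : φ (fun m => |MvPolynomial.eval (fun i => y m i) s|) * φ D ^ j < 1 := by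
      rw [← map_pow, ← map_mul, ← map_one φ, hlt]
      have : ∀ᶠ m in (Filter.hyperfilter ℕ : Filter ℕ), j + 1 ≤ m :=
        Nat.hyperfilter_le_atTop (Filter.eventually_ge_atTop (j + 1))
      filter_upwards [this] with m hm
      have h1 := hs m
      have h2 := hD m
      change |MvPolynomial.eval (y m) s| * D m ^ j < 1
      have h3 : D m ^ (j + 1) ≤ D m ^ m := pow_le_pow_right₀ (by linarith) hm
      have h4 := mul_le_mul_of_nonneg_left h3 (abs_nonneg (MvPolynomial.eval (y m) s))
      have h5 : 0 ≤ |MvPolynomial.eval (y m) s| * D m ^ j := by positivity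
      rw [pow_succ] at h4
      nlinarith
    refine lt_of_le_of_lt ?_ hlt1
    refine mul_le_mul_of_nonneg_left hj ?_
    rw [← habs]; exact abs_nonneg _
  -- polynomial maps respect congruence
  have hcong : ∀ p : MvPolynomial (Fin n) ℝ,
      InfOf O (MvPolynomial.eval₂ cst (fun i => φ (fun m => y m i)) p -
        MvPolynomial.eval₂ cst x' p) ∧ MvPolynomial.eval₂ cst x' p ∈ K ∧
        MvPolynomial.eval₂ cst (fun i => φ (fun m => y m i)) p ∈ O := by
    intro p
    induction p using MvPolynomial.induction_on with
    | C a =>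
      simp only [MvPolynomial.eval₂_C, sub_self]
      exact ⟨InfOf.zero, hFK ⟨a, rfl⟩, hF0 _ ⟨a, rfl⟩⟩
    | add p q hp hq =>
      simp only [MvPolynomial.eval₂_add]
      refine ⟨?_, K.add_mem hp.2.1 hq.2.1, O.add_mem hp.2.2 hq.2.2⟩
      have := hp.1.add hq.1
      convert this using 1
      ring
    | mul_X p i hp =>
      simp only [MvPolynomial.eval₂_mul, MvPolynomial.eval₂_X]
      refine ⟨?_, K.mul_mem hp.2.1 (hx'K i), O.mul_mem hp.2.2 (hyO i)⟩
      have := (hp.1.mul (hyO i)).add ((hx' i).mul (hKO _ hp.2.1))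
      convert this using 1
      ring
  have hsx : MvPolynomial.eval₂ cst x' s = 0 := by
    obtain ⟨h1, h2, _⟩ := hcong s
    have h3 : InfOf O (MvPolynomial.eval₂ cst x' s) := by
      have := hsy.sub h1
      simpa using this
    by_contra hne
    have := h3 _ (hKO _ (K.inv_mem h2))
    rw [mul_inv_cancel₀ hne] at this
    simp at this
  choose u hu using fun i => hsurj (x' i)
  have hx'eq : x' = fun i => φ (u i) := by funext i; exact (hu i).symm
  rw [hx'eq, hev, ← map_zero φ, heq] at hsx
  have hclose : ∀ᶠ m in (Filter.hyperfilter ℕ : Filter ℕ), ∀ i, |y m i - u i m| * D m ^ k ≤ 1 := by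
    rw [Filter.eventually_all]
    intro i
    have h1 := hx' i (φ D ^ k) ⟨k, by rw [abs_of_nonneg]; exact pow_nonneg (by linarith) _⟩
    rw [← hu i, ← map_sub, ← map_pow, ← map_mul, habs, ← map_one φ, hlt] at h1
    filter_upwards [h1] with m hm
    have hDm : 0 ≤ D m ^ k := pow_nonneg (by linarith [hD m]) _
    change |(y m i - u i m) * D m ^ k| < 1 at hm
    rw [abs_mul, abs_of_nonneg hDm] at hm
    exact hm.le
  obtain ⟨m, hm1, hm2⟩ := (hsx.and hclose).exists
  obtain ⟨i, hi⟩ := hbad m (fun i => u i m) hm1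
  exact absurd (hm2 i) (not_le.mpr hi)

theorem algSet_sos {n : ℕ} {X : Set (Fin n → ℝ)} (hX : IsRealAlgebraicSet X) :
    ∃ s : MvPolynomial (Fin n) ℝ, (∀ x, 0 ≤ MvPolynomial.eval x s) ∧
      ∀ x, x ∈ X ↔ MvPolynomial.eval x s = 0 := by
  obtain ⟨k, p, rfl⟩ := hX
  refine ⟨∑ i, p i ^ 2, ?_, ?_⟩
  · intro x
    simp only [map_sum, map_pow]
    exact Finset.sum_nonneg fun i _ => sq_nonneg _
  · intro x
    simp only [map_sum, map_pow, Set.mem_setOf_eq]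
    rw [Finset.sum_eq_zero_iff_of_nonneg (fun i _ => sq_nonneg _)]
    simp

theorem isAlg_zero {n : ℕ} (s : MvPolynomial (Fin n) ℝ) :
    IsRealAlgebraicSet {x | MvPolynomial.eval x s = 0} :=
  ⟨1, fun _ => s, by ext x; simp⟩

/-- The ideal of denominators of `f` on `X`. -/
noncomputable def denIdeal {n : ℕ} (X : Set (Fin n → ℝ)) (f : (Fin n → ℝ) → ℝ) :
    Ideal (MvPolynomial (Fin n) ℝ) where
  carrier := {b | ∃ a : MvPolynomial (Fin n) ℝ, ∀ x ∈ X,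
    MvPolynomial.eval x a = f x * MvPolynomial.eval x b}
  add_mem' := by
    rintro b c ⟨a, ha⟩ ⟨d, hd⟩
    refine ⟨a + d, fun x hx => ?_⟩
    rw [map_add, map_add, ha x hx, hd x hx]; ring
  zero_mem' := ⟨0, fun x _ => by simp⟩
  smul_mem' := by
    rintro c b ⟨a, ha⟩
    refine ⟨c * a, fun x hx => ?_⟩
    rw [smul_eq_mul, map_mul, map_mul, ha x hx]; ring

theorem exists_global_fraction {n : ℕ} {X : Set (Fin n → ℝ)} (hX : IsRealAlgebraicSet X)
    (f : (Fin n → ℝ) → ℝ) :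
    ∃ a b : MvPolynomial (Fin n) ℝ, (∀ x, 0 ≤ MvPolynomial.eval x b) ∧
      (∀ x ∈ X, MvPolynomial.eval x a = f x * MvPolynomial.eval x b) ∧
      ∀ x ∈ X, (MvPolynomial.eval x b = 0 ↔ x ∈ polarLocus X f) := by
  obtain ⟨s, hs0, hs⟩ := algSet_sos hX
  obtain ⟨T, hT⟩ := (isNoetherianRing_iff_ideal_fg _).mp
    (inferInstance : IsNoetherianRing (MvPolynomial (Fin n) ℝ)) (denIdeal X f)
  have hTm : ∀ t ∈ T, t ∈ denIdeal X f := by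
    intro t ht
    rw [← hT]; exact Ideal.subset_span ht
  have hb : ∑ t ∈ T, t ^ 2 ∈ denIdeal X f := by
    refine Ideal.sum_mem _ fun t ht => ?_
    rw [pow_two]; exact Ideal.mul_mem_left _ _ (hTm t ht)
  obtain ⟨a, ha⟩ := hb
  have hz : ∀ x, MvPolynomial.eval x (∑ t ∈ T, t ^ 2) = 0 ↔
      ∀ b ∈ denIdeal X f, MvPolynomial.eval x b = 0 := by
    intro x
    simp only [map_sum, map_pow]
    rw [Finset.sum_eq_zero_iff_of_nonneg (fun i _ => sq_nonneg _)]
    constructor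
    · intro h b hb
      have : denIdeal X f ≤ RingHom.ker (MvPolynomial.eval x) := by
        rw [← hT, Ideal.span_le]
        intro t ht
        have := h t ht
        exact (RingHom.mem_ker).mpr (by simpa using this)
      exact RingHom.mem_ker.mp (this hb)
    · intro h t ht
      rw [h t (hTm t ht)]; simp
  refine ⟨a, ∑ t ∈ T, t ^ 2, ?_, ha, ?_⟩
  · intro x
    simp only [map_sum, map_pow]
    exact Finset.sum_nonneg fun i _ => sq_nonneg _
  · intro x hx
    rw [hz]
    constructor
    · intro h
      refine ⟨hx, ?_⟩
      rintro ⟨U, ⟨⟨hUX, hU⟩, p, q, hq, hpq⟩, hxU⟩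
      obtain ⟨u, hu0, hu⟩ := algSet_sos hU
      have hmem : q * u ∈ denIdeal X f := by
        refine ⟨p * u, fun y hy => ?_⟩
        by_cases hyU : y ∈ U
        · rw [map_mul, map_mul, hpq y hyU]
          have := hq y hyU
          field_simp
        · have := (hu y).mp ⟨hy, hyU⟩
          rw [map_mul, map_mul, this]; ring
      have h1 := h _ hmem
      rw [map_mul, mul_eq_zero] at h1
      rcases h1 with h1 | h1
      · exact hq x hxU h1
      · exact ((hu x).mpr h1).2 hxU
    · rintro ⟨_, h⟩ b ⟨c, hc⟩
      by_contra hne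
      apply h
      refine ⟨{y | y ∈ X ∧ MvPolynomial.eval y b ≠ 0}, ⟨⟨fun y hy => hy.1, ?_⟩, c, b, fun y hy => hy.2, ?_⟩, hx, hne⟩
      · have : X \ {y | y ∈ X ∧ MvPolynomial.eval y b ≠ 0} =
            {y | MvPolynomial.eval y (s + b ^ 2) = 0} := by
          ext y
          simp only [Set.mem_diff, Set.mem_setOf_eq, map_add, map_pow, hs y]
          have := hs0 y
          constructor
          · rintro ⟨h1, h2⟩
            have : MvPolynomial.eval y b = 0 := by
              by_contra h3; exact h2 ⟨h1, h3⟩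
            rw [h1, this]; simp
          · intro h1
            have h2 : MvPolynomial.eval y s = 0 := by nlinarith [sq_nonneg (MvPolynomial.eval y b)]
            have h3 : MvPolynomial.eval y b ^ 2 = 0 := by linarith
            exact ⟨h2, fun h4 => h4.2 (by simpa using h3)⟩
        rw [this]; exact isAlg_zero _
      · intro y hy
        rw [hc y hy.1]
        have := hy.2
        field_simp

theorem poly_lip {n : ℕ} (p : MvPolynomial (Fin n) ℝ) (R : ℝ) (hR : 0 ≤ R) :
    ∃ L : ℝ, 1 ≤ L ∧ ∀ (x y : Fin n → ℝ) (δ : ℝ), (∀ i, |x i| ≤ R) → (∀ i, |y i| ≤ R) →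
      0 ≤ δ → (∀ i, |x i - y i| ≤ δ) → |MvPolynomial.eval x p| ≤ L ∧
      |MvPolynomial.eval x p - MvPolynomial.eval y p| ≤ L * δ := by
  induction p using MvPolynomial.induction_on with
  | C a =>
    refine ⟨|a| + 1, by linarith [abs_nonneg a], fun x y δ _ _ hδ _ => ?_⟩
    simp only [MvPolynomial.eval_C, sub_self, abs_zero]
    exact ⟨by linarith, by positivity⟩
  | add p q hp hq =>
    obtain ⟨L, hL, hp⟩ := hp
    obtain ⟨M, hM, hq⟩ := hq
    refine ⟨L + M, by linarith, fun x y δ hx hy hδ hxy => ?_⟩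
    obtain ⟨h1, h2⟩ := hp x y δ hx hy hδ hxy
    obtain ⟨h3, h4⟩ := hq x y δ hx hy hδ hxy
    simp only [map_add]
    refine ⟨(abs_add_le _ _).trans (by linarith), ?_⟩
    rw [add_sub_add_comm]
    exact (abs_add_le _ _).trans (by linarith)
  | mul_X p i hp =>
    obtain ⟨L, hL, hp⟩ := hp
    refine ⟨L * (R + 1), by nlinarith, fun x y δ hx hy hδ hxy => ?_⟩
    obtain ⟨h1, h2⟩ := hp x y δ hx hy hδ hxy
    simp only [map_mul, MvPolynomial.eval_X]
    constructor
    · rw [abs_mul]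
      exact mul_le_mul h1 ((hx i).trans (by linarith)) (abs_nonneg _) (by linarith)
    · have e : MvPolynomial.eval x p * x i - MvPolynomial.eval y p * y i =
        MvPolynomial.eval x p * (x i - y i) +
          (MvPolynomial.eval x p - MvPolynomial.eval y p) * y i := by ring
      rw [e]
      refine (abs_add_le _ _).trans ?_
      rw [abs_mul, abs_mul]
      have h3 := mul_le_mul h1 (hxy i) (abs_nonneg _) (by linarith)
      have h4 := mul_le_mul h2 (hy i) (abs_nonneg _) (by positivity)
      nlinarith

/-- Pure real-number estimate, far from `X`. -/
theorem estA (a b g s D L G : ℝ) (M : ℕ) (hb : 0 < b) (hs : 0 ≤ s) (hD : 1 ≤ D) (hbD : 1 ≤ b * D)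
    (ha : |a| ≤ L) (hg : |g| ≤ G) (hsD : 1 ≤ s * D ^ M) :
    |(a / b - g) * (1 / (1 + s * D ^ (M + 2)))| ≤ (L + G) * b := by
  have hL : 0 ≤ L := (abs_nonneg _).trans ha
  have hG : 0 ≤ G := (abs_nonneg _).trans hg
  have hD0 : 0 < D := by linarith
  have hib : 1 / b ≤ D := by rw [div_le_iff₀ hb]; linarith
  have hiD : 1 / D ≤ b := by rw [div_le_iff₀ hD0]; linarith
  have h1 : |a / b - g| ≤ (L + G) * D := by
    refine (abs_sub _ _).trans ?_
    rw [abs_div, abs_of_pos hb]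
    have : |a| / b ≤ L * D := by
      rw [div_eq_mul_one_div]
      exact mul_le_mul ha hib (by positivity) hL
    nlinarith
  have h2 : D ^ 2 ≤ 1 + s * D ^ (M + 2) := by
    have : s * D ^ (M + 2) = (s * D ^ M) * D ^ 2 := by ring
    rw [this]; nlinarith [sq_nonneg D]
  have h3 : 1 / (1 + s * D ^ (M + 2)) ≤ 1 / D ^ 2 := one_div_le_one_div_of_le (by positivity) h2
  have h4 : 0 ≤ 1 / (1 + s * D ^ (M + 2)) := by positivity
  rw [abs_mul, abs_of_nonneg h4]
  calc _ ≤ ((L + G) * D) * (1 / D ^ 2) := mul_le_mul h1 h3 h4 (by positivity)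
    _ = (L + G) * (1 / D) := by field_simp
    _ ≤ _ := mul_le_mul_of_nonneg_left hiD (by positivity)

/-- Pure real-number estimate, near `X`. -/
theorem estB (a b a' b' L δ : ℝ) (hb : 0 < b) (hb1 : b ≤ 1) (hL : 1 ≤ L) (ha : |a| ≤ L)
    (hδ : δ ≤ b ^ 3) (haa : |a - a'| ≤ L * δ) (hbb : |b - b'| ≤ L * δ)
    (hsm : 2 * L * b ≤ 1) : 0 < b' ∧ |a / b - a' / b'| ≤ 4 * L ^ 2 * b := by
  have h0 : L * δ ≤ L * b ^ 3 := mul_le_mul_of_nonneg_left hδ (by linarith)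
  have h1 : L * b ^ 3 ≤ b / 2 := by
    have : b ^ 2 ≤ b := by nlinarith
    have h2 : L * b ^ 2 ≤ 1 / 2 := by nlinarith
    calc L * b ^ 3 = (L * b ^ 2) * b := by ring
      _ ≤ _ := by nlinarith
  have hb' : b / 2 ≤ b' := by
    have := (abs_le.mp hbb).2
    linarith
  have hb'0 : 0 < b' := by linarith
  refine ⟨hb'0, ?_⟩
  have e : a / b - a' / b' = (a * (b' - b) + b * (a - a')) / (b * b') := by
    field_simp; ring
  rw [e, abs_div, abs_of_pos (mul_pos hb hb'0), div_le_iff₀ (mul_pos hb hb'0)]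
  refine (abs_add_le _ _).trans ?_
  rw [abs_mul, abs_mul, abs_sub_comm b' b, abs_of_pos hb]
  have h2 : |a| * |b - b'| ≤ L * (L * b ^ 3) :=
    mul_le_mul ha (hbb.trans h0) (abs_nonneg _) (by linarith)
  have h3 : b * |a - a'| ≤ 1 * (L * b ^ 3) :=
    mul_le_mul hb1 (haa.trans h0) (abs_nonneg _) (by linarith)
  have h4 : 1 * (L * b ^ 3) ≤ L * (L * b ^ 3) := mul_le_mul_of_nonneg_right hL (by positivity)
  have h5 : 4 * L ^ 2 * b * (b * (b / 2)) ≤ 4 * L ^ 2 * b * (b * b') := by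
    gcongr
  nlinarith

theorem tendsto_corr {n : ℕ} (X : Set (Fin n → ℝ)) (f g : (Fin n → ℝ) → ℝ)
    (hf : ContinuousOn f X) (hg : Continuous g) (a b s : MvPolynomial (Fin n) ℝ)
    (hb : ∀ x, 0 ≤ MvPolynomial.eval x b) (hs : ∀ x, 0 ≤ MvPolynomial.eval x s)
    (hX : ∀ x, x ∈ X ↔ MvPolynomial.eval x s = 0)
    (hab : ∀ x ∈ X, MvPolynomial.eval x a = f x * MvPolynomial.eval x b) (M : ℕ)
    (hM : ∀ (y : Fin n → ℝ) (D : ℝ), 2 ≤ D → (∀ i, |y i| ≤ D) →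
      |MvPolynomial.eval y s| * D ^ M ≤ 1 →
      ∃ x : Fin n → ℝ, MvPolynomial.eval x s = 0 ∧ ∀ i, |y i - x i| * D ^ 3 ≤ 1)
    (x0 : Fin n → ℝ) (hx0 : x0 ∈ X) (hbx0 : MvPolynomial.eval x0 b = 0) (hfg : f x0 = g x0) :
    ∀ ε > 0, ∀ᶠ y in nhds x0, 0 < MvPolynomial.eval y b →
      |(MvPolynomial.eval y a / MvPolynomial.eval y b - g y) *
        (1 / (1 + MvPolynomial.eval y s *
          (2 + ∑ i, y i ^ 2 + 1 / MvPolynomial.eval y b) ^ (M + 2)))| < ε := by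
  intro ε hε
  obtain ⟨R, hR⟩ : ∃ R : ℝ, R = ‖x0‖ + 2 := ⟨_, rfl⟩
  have hR0 : 0 ≤ R := by rw [hR]; positivity
  obtain ⟨La, hLa, hla⟩ := poly_lip a R hR0
  obtain ⟨Lb, hLb, hlb⟩ := poly_lip b R hR0
  obtain ⟨L, hL⟩ : ∃ L : ℝ, L = max La Lb := ⟨_, rfl⟩
  have hLaL : La ≤ L := hL ▸ le_max_left _ _
  have hLbL : Lb ≤ L := hL ▸ le_max_right _ _
  have hL1 : 1 ≤ L := hLa.trans hLaL
  obtain ⟨ρ, hρ, hfρ⟩ := Metric.continuousOn_iff.mp hf x0 hx0 (ε / 4) (by positivity)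
  have hbt : Filter.Tendsto (fun y => MvPolynomial.eval y b) (nhds x0) (nhds 0) := by
    rw [← hbx0]; exact (MvPolynomial.continuous_eval b).tendsto x0
  have hsmall : ∀ c > 0, ∀ᶠ y in nhds x0, MvPolynomial.eval y b < c := fun c hc =>
    hbt.eventually_lt_const hc
  have hgG : ∀ᶠ y in nhds x0, |g y - g x0| < min (ε / 4) 1 := by
    have := Metric.continuousAt_iff'.mp (hg.continuousAt (x := x0)) (min (ε / 4) 1) (by positivity)
    simpa [Real.dist_eq] using this
  have hnear : ∀ᶠ y in nhds x0, dist y x0 < min 1 (ρ / 2) :=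
    Metric.ball_mem_nhds x0 (by positivity)
  have hC : 0 < L + (|g x0| + 1) := by positivity
  filter_upwards [hsmall 1 one_pos, hsmall (1 / (2 * L)) (by positivity),
    hsmall (ε / (16 * L ^ 2)) (by positivity), hsmall (ρ / 2) (by positivity),
    hsmall (ε / (L + (|g x0| + 1))) (by positivity), hgG, hnear] with y h1 h2 h3 h4 h5 h6 h7 hpos
  rw [lt_div_iff₀ (by positivity)] at h2 h3 h5
  obtain ⟨D, hDdef⟩ : ∃ D, D = 2 + ∑ i, y i ^ 2 + 1 / MvPolynomial.eval y b := ⟨_, rfl⟩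
  rw [← hDdef]
  obtain ⟨B, hB⟩ : ∃ B, B = MvPolynomial.eval y b := ⟨_, rfl⟩
  rw [← hB] at h1 h2 h3 h4 h5 hpos hDdef ⊢
  have hsum : 0 ≤ ∑ i, y i ^ 2 := Finset.sum_nonneg fun i _ => sq_nonneg _
  have hiB : 0 < 1 / B := by positivity
  have hD2 : 2 ≤ D := by rw [hDdef]; linarith
  have hBD : 1 ≤ B * D := by
    have : 1 / B ≤ D := by rw [hDdef]; linarith
    rw [div_le_iff₀ hpos] at this; linarith
  have hyD : ∀ i, |y i| ≤ D := by
    intro i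
    have h8 : y i ^ 2 ≤ ∑ i, y i ^ 2 :=
      Finset.single_le_sum (f := fun i => y i ^ 2) (fun i _ => sq_nonneg _) (Finset.mem_univ i)
    have h9 : |y i| ≤ 1 + y i ^ 2 := by
      rw [← sq_abs]; nlinarith [sq_nonneg (|y i| - 1)]
    rw [hDdef]; linarith
  have hyx : ∀ i, |y i - x0 i| ≤ dist y x0 := fun i => by
    have := dist_le_pi_dist y x0 i
    rwa [Real.dist_eq] at this
  have hx0i : ∀ i, |x0 i| ≤ ‖x0‖ := fun i => by
    have := norm_le_pi_norm x0 i
    rwa [Real.norm_eq_abs] at this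
  have h71 := h7.trans_le (min_le_left _ _)
  have h72 := h7.trans_le (min_le_right _ _)
  have h61 := h6.trans_le (min_le_left _ _)
  have h62 := h6.trans_le (min_le_right _ _)
  have hyR : ∀ i, |y i| ≤ R := by
    intro i
    have := abs_add_le (y i - x0 i) (x0 i)
    rw [sub_add_cancel] at this
    linarith [hyx i, hx0i i]
  have haL : |MvPolynomial.eval y a| ≤ L :=
    (hla y y 0 hyR hyR le_rfl (by simp)).1.trans hLaL
  by_cases hcase : MvPolynomial.eval y s * D ^ M ≤ 1
  · obtain ⟨x, hxs, hx⟩ := hM y D hD2 hyD (by rwa [abs_of_nonneg (hs y)])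
    have hxX := (hX x).mpr hxs
    have hδ : ∀ i, |y i - x i| ≤ B ^ 3 := by
      intro i
      have hh : 1 ≤ (B * D) ^ 3 := one_le_pow₀ hBD
      rw [mul_pow] at hh
      have hD3 : 0 < D ^ 3 := by positivity
      exact le_of_mul_le_mul_right ((hx i).trans hh) hD3
    have hB3 : B ^ 3 ≤ B := pow_le_of_le_one hpos.le h1.le (by norm_num)
    have hxR : ∀ i, |x i| ≤ R := by
      intro i
      have e : x i = (y i - x0 i) + x0 i - (y i - x i) := by ring
      have t1 := abs_sub ((y i - x0 i) + x0 i) (y i - x i)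
      have t2 := abs_add_le (y i - x0 i) (x0 i)
      rw [← e] at t1
      linarith [hyx i, hx0i i, hδ i]
    have hB30 : 0 ≤ B ^ 3 := by positivity
    have ha' := (hla y x (B ^ 3) hyR hxR hB30 hδ).2
    have hb' := (hlb y x (B ^ 3) hyR hxR hB30 hδ).2
    rw [← hB] at hb'
    obtain ⟨hbx, hest⟩ := estB (MvPolynomial.eval y a) B (MvPolynomial.eval x a)
      (MvPolynomial.eval x b) L (B ^ 3) hpos h1.le hL1 haL le_rfl
      (ha'.trans (mul_le_mul_of_nonneg_right hLaL hB30))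
      (hb'.trans (mul_le_mul_of_nonneg_right hLbL hB30)) (by linarith)
    have hfx : MvPolynomial.eval x a / MvPolynomial.eval x b = f x := by
      rw [hab x hxX]; field_simp
    rw [hfx] at hest
    have hxx0 : dist x x0 < ρ := by
      have t : dist x y ≤ B := by
        rw [dist_pi_le_iff hpos.le]
        intro i
        rw [Real.dist_eq, abs_sub_comm]
        exact (hδ i).trans hB3
      linarith [dist_triangle x y x0]
    have hff := hfρ x hxX hxx0
    rw [Real.dist_eq, hfg] at hff
    have hmain : |MvPolynomial.eval y a / B - g y| < ε := by
      rw [abs_lt] at *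
      rw [abs_le] at hest
      constructor <;> linarith [hest.1, hest.2, hff.1, hff.2, h61.1, h61.2]
    have hψ0 : 0 ≤ MvPolynomial.eval y s * D ^ (M + 2) := mul_nonneg (hs y) (by positivity)
    have hψ : 1 / (1 + MvPolynomial.eval y s * D ^ (M + 2)) ≤ 1 := by
      rw [div_le_one (by positivity)]; linarith
    rw [abs_mul, abs_of_nonneg (a := 1 / (1 + MvPolynomial.eval y s * D ^ (M + 2))) (by positivity)]
    exact lt_of_le_of_lt (mul_le_of_le_one_right (abs_nonneg _) hψ) hmain
  · push Not at hcase
    have hgy : |g y| ≤ |g x0| + 1 := by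
      have := abs_add_le (g y - g x0) (g x0)
      rw [sub_add_cancel] at this
      linarith
    have := estA (MvPolynomial.eval y a) B (g y) (MvPolynomial.eval y s) D L (|g x0| + 1) M hpos
      (hs y) (by linarith) hBD haL hgy hcase.le
    linarith

/-- if the restriction of a rational continuous function `f` on `X` to its polar
locus is regulous, then `f` is regulous on `X`. -/
theorem regulous_of_regulous_on_polarLocus {n : ℕ} (X : Set (Fin n → ℝ))
    (hX : IsRealAlgebraicSet X) (f : (Fin n → ℝ) → ℝ) (hf : IsRatCont X f)
    (hW : IsRegulousOn (polarLocus X f) f) :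
    IsRegulousOn X f := by
  obtain ⟨g, hg, hfg⟩ := hW
  obtain ⟨hgc, Ug, ⟨-, hUg⟩, ⟨xg, hxg⟩, P, Q, hQ, hPQ⟩ := hg
  obtain ⟨s, hs0, hs⟩ := algSet_sos hX
  obtain ⟨a, b0, hb00, hab0, hW0⟩ := exists_global_fraction hX f
  obtain ⟨b, hbdef⟩ : ∃ b, b = b0 + s := ⟨_, rfl⟩
  have hbe : ∀ x, MvPolynomial.eval x b = MvPolynomial.eval x b0 + MvPolynomial.eval x s := by
    intro x; rw [hbdef, map_add]
  have hb : ∀ x, 0 ≤ MvPolynomial.eval x b := fun x => by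
    rw [hbe]; exact add_nonneg (hb00 x) (hs0 x)
  have hbz : ∀ x, MvPolynomial.eval x b = 0 → x ∈ X ∧ f x = g x := by
    intro x hx
    rw [hbe] at hx
    have h1 := hb00 x
    have h2 := hs0 x
    have hxX : x ∈ X := (hs x).mpr (by linarith)
    exact ⟨hxX, hfg x ((hW0 x hxX).mp (by linarith))⟩
  have hab : ∀ x ∈ X, MvPolynomial.eval x a = f x * MvPolynomial.eval x b := by
    intro x hx
    rw [hbe, (hs x).mp hx, add_zero, hab0 x hx]
  by_cases hbzero : b = 0
  · refine ⟨g, ⟨hgc, Ug, ⟨Set.subset_univ _, hUg⟩, ⟨xg, hxg⟩, P, Q, hQ, hPQ⟩, fun x hx => ?_⟩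
    exact (hbz x (by rw [hbzero, map_zero])).2
  obtain ⟨M, hM⟩ := lojasiewicz s 3
  let ψ : (Fin n → ℝ) → ℝ := fun y => (MvPolynomial.eval y a / MvPolynomial.eval y b - g y) *
    (1 / (1 + MvPolynomial.eval y s *
      (2 + ∑ i, y i ^ 2 + 1 / MvPolynomial.eval y b) ^ (M + 2)))
  let F : (Fin n → ℝ) → ℝ := fun y => if MvPolynomial.eval y b = 0 then g y else g y + ψ y
  have hden : ∀ y, 0 < MvPolynomial.eval y b → 0 < 1 + MvPolynomial.eval y s *
      (2 + ∑ i, y i ^ 2 + 1 / MvPolynomial.eval y b) ^ (M + 2) := by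
    intro y hy
    have hsum : 0 ≤ ∑ i, y i ^ 2 := Finset.sum_nonneg fun i _ => sq_nonneg _
    have := hs0 y
    positivity
  have hbpos : ∀ y, MvPolynomial.eval y b ≠ 0 → 0 < MvPolynomial.eval y b := fun y hy =>
    lt_of_le_of_ne (hb y) (Ne.symm hy)
  have hbc : Continuous fun y => MvPolynomial.eval y b := MvPolynomial.continuous_eval b
  refine ⟨F, ⟨?_, ?_⟩, ?_⟩
  · rw [continuous_iff_continuousAt]
    intro x0
    by_cases hx0 : MvPolynomial.eval x0 b = 0
    · obtain ⟨hx0X, hfgx⟩ := hbz x0 hx0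
      have hF0 : F x0 = g x0 := if_pos hx0
      rw [Metric.continuousAt_iff']
      intro ε hε
      have t1 := tendsto_corr X f g hf.1 hgc a b s hb hs0 hs hab M hM x0 hx0X hx0 hfgx (ε / 2)
        (by positivity)
      have t2 := Metric.continuousAt_iff'.mp (hgc.continuousAt (x := x0)) (ε / 2) (by positivity)
      filter_upwards [t1, t2] with y h1 h2
      rw [hF0]
      rw [Real.dist_eq] at h2 ⊢
      by_cases hy : MvPolynomial.eval y b = 0
      · have : F y = g y := if_pos hy
        rw [this]; linarith
      · have : F y = g y + ψ y := if_neg hy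
        rw [this]
        have h3 : |ψ y| < ε / 2 := h1 (hbpos y hy)
        rw [abs_lt] at *
        constructor <;> linarith [h2.1, h2.2, h3.1, h3.2]
    · have hev : F =ᶠ[nhds x0] fun y => g y + ψ y := by
        filter_upwards [hbc.continuousAt.eventually_ne hx0] with y hy
        exact if_neg hy
      refine ContinuousAt.congr ?_ hev.symm
      have hac : Continuous fun y => MvPolynomial.eval y a := MvPolynomial.continuous_eval a
      have hsc : Continuous fun y => MvPolynomial.eval y s := MvPolynomial.continuous_eval s
      have hinv : ContinuousAt (fun y => 1 / MvPolynomial.eval y b) x0 :=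
        continuousAt_const.div hbc.continuousAt hx0
      have hsq : ContinuousAt (fun y : Fin n → ℝ => 2 + ∑ i, y i ^ 2) x0 := by
        apply Continuous.continuousAt; fun_prop
      refine hgc.continuousAt.add (((hac.continuousAt.div hbc.continuousAt hx0).sub
        hgc.continuousAt).mul (continuousAt_const.div (continuousAt_const.add
          (hsc.continuousAt.mul ((hsq.add hinv).pow _))) (hden x0 (hbpos x0 hx0)).ne'))
  · obtain ⟨u, hu0, hu⟩ := algSet_sos hUg
    have hune : u ≠ 0 := by
      rintro rfl
      exact ((hu xg).mpr (by simp)).2 hxg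
    have hprod : u * b ≠ 0 := mul_ne_zero hune hbzero
    let E : MvPolynomial (Fin n) ℝ := b * (2 + ∑ i, MvPolynomial.X i ^ 2) + 1
    let T : MvPolynomial (Fin n) ℝ := b ^ (M + 2) + s * E ^ (M + 2)
    have hEe : ∀ y, MvPolynomial.eval y E = MvPolynomial.eval y b * (2 + ∑ i, y i ^ 2) + 1 := by
      intro y
      simp [E, map_sum]
    have hTe : ∀ y, MvPolynomial.eval y T = MvPolynomial.eval y b ^ (M + 2) +
        MvPolynomial.eval y s * (MvPolynomial.eval y b * (2 + ∑ i, y i ^ 2) + 1) ^ (M + 2) := by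
      intro y
      rw [← hEe]; simp [T]
    have hTb : ∀ y, MvPolynomial.eval y b ≠ 0 → MvPolynomial.eval y T =
        MvPolynomial.eval y b ^ (M + 2) * (1 + MvPolynomial.eval y s *
      (2 + ∑ i, y i ^ 2 + 1 / MvPolynomial.eval y b) ^ (M + 2)) := by
      intro y hy
      have e : MvPolynomial.eval y b * (2 + ∑ i, y i ^ 2) + 1 =
        MvPolynomial.eval y b * (2 + ∑ i, y i ^ 2 + 1 / MvPolynomial.eval y b) := by
        field_simp
      rw [hTe, e, mul_pow]; ring
    have hUsub : ∀ y, MvPolynomial.eval y (u * b) ≠ 0 → y ∈ Ug ∧ MvPolynomial.eval y b ≠ 0 := by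
      intro y hy
      rw [map_mul] at hy
      refine ⟨?_, right_ne_zero_of_mul hy⟩
      by_contra hyU
      exact left_ne_zero_of_mul hy ((hu y).mp ⟨Set.mem_univ _, hyU⟩)
    refine ⟨{y | MvPolynomial.eval y (u * b) ≠ 0}, ⟨Set.subset_univ _, ?_⟩, ?_,
      P * b * T + (a * Q - P * b) * b ^ (M + 2), Q * b * T, ?_, ?_⟩
    · have : Set.univ \ {y | MvPolynomial.eval y (u * b) ≠ 0} =
          {y | MvPolynomial.eval y (u * b) = 0} := by
        ext y; simp; tauto
      rw [this]; exact isAlg_zero _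
    · by_contra hemp
      apply hprod
      apply MvPolynomial.funext
      intro y
      rw [map_zero]
      by_contra hy
      exact hemp ⟨y, hy⟩
    · intro y hy
      obtain ⟨h1, h2⟩ := hUsub y hy
      rw [map_mul, map_mul, hTb y h2]
      exact mul_ne_zero (mul_ne_zero (hQ y h1) h2)
        (mul_ne_zero (pow_ne_zero _ h2) (hden y (hbpos y h2)).ne')
    · intro y hy
      obtain ⟨h1, h2⟩ := hUsub y hy
      have hFy : F y = g y + ψ y := if_neg h2
      have h3 := hQ y h1
      have h4 := (hden y (hbpos y h2)).ne'
      rw [hFy]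
      simp only [ψ, map_add, map_mul, map_sub, map_pow]
      rw [hTb y h2, hPQ y h1]
      generalize (1 + MvPolynomial.eval y s *
        (2 + ∑ i, y i ^ 2 + 1 / MvPolynomial.eval y b) ^ (M + 2)) = H at *
      have h5 : MvPolynomial.eval y b ^ (M + 2) ≠ 0 := pow_ne_zero _ h2
      generalize MvPolynomial.eval y b ^ (M + 2) = B at *
      field_simp
  · intro x hx
    by_cases hxb : MvPolynomial.eval x b = 0
    · have : F x = g x := if_pos hxb
      rw [this]; exact (hbz x hxb).2
    · have : F x = g x + ψ x := if_neg hxb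
      rw [this]
      simp only [ψ]
      rw [hab x hx, (hs x).mp hx]
      field_simp
      ring
end
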